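/- arXiv:0904.0861 — 7 statements merged into one kernel-verified Lean document; each statement's English description precedes it below -/
import Mathlib

section
/- An Abelian exchange ring with no central idempotents other than 0 and 1 is a local ring. -/
/-- An Abelian exchange ring with no central idempotents other than `0` and `1`
is a local ring. -/
theorem abelian_exchange_no_nontrivial_central_idempotents_isLocalRing
    {R : Type*} [Ring R] [Nontrivial R]
    (habelian : ∀ e : R, IsIdempotentElem e → ∀ r : R, e * r = r * e)
    (hexchange : ∀ a : R, ∃ e : R, IsIdempotentElem e ∧
      (∃ r : R, e = a * r) ∧ (∃ s : R, 1 - e = (1 - a) * s))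
    (hidem : ∀ e : R, IsIdempotentElem e → (∀ r : R, e * r = r * e) → e = 0 ∨ e = 1) :
    IsLocalRing R := by
  have key : ∀ a r : R, a * r = 1 → IsUnit a := by
    intro a r h
    have hi : IsIdempotentElem (r * a) := by
      show r * a * (r * a) = r * a
      rw [mul_assoc, ← mul_assoc a r a, h, one_mul]
    rcases hidem _ hi (habelian _ hi) with h0 | h1
    · exfalso
      have h2 : a * (r * a) * r = 1 := by
        rw [← mul_assoc, h, one_mul, h]
      rw [h0, mul_zero, zero_mul] at h2
      exact zero_ne_one h2
    · exact ⟨⟨a, r, h, h1⟩, rfl⟩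
  refine IsLocalRing.of_is_unit_or_is_unit_of_add_one ?_
  intro a b hab
  obtain ⟨e, he, ⟨r, hr⟩, ⟨s, hs⟩⟩ := hexchange a
  have hb : 1 - a = b := by rw [← hab]; abel
  rcases hidem e he (habelian e he) with h0 | h1
  · right
    rw [h0, sub_zero, hb] at hs
    exact key b s hs.symm
  · left
    rw [h1] at hr
    exact key a r hr.symm
end

section
/- If R is an Abelian exchange ring, then the group ring R[ℤ/2ℤ] of the cyclic group of order 2 over R is a clean ring: every element of R[ℤ/2ℤ] is a sum of an idempotent and a unit. -/
namespace CleanC2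

/-- `y` is invertible on the part of the ring cut out by `f`. -/
def U {R : Type*} [Ring R] (f y : R) : Prop := ∃ z, f * y * z = f ∧ f * z * y = f

lemma U.mul_left {R : Type*} [Ring R] {f y : R} (h : U f y) (k : R) : U (k * f) y := by
  obtain ⟨z, h1, h2⟩ := h
  exact ⟨z, by rw [mul_assoc k, mul_assoc k, h1], by rw [mul_assoc k, mul_assoc k, h2]⟩

lemma U.neg {R : Type*} [Ring R] {f y : R} (h : U f y) : U f (-y) := by
  obtain ⟨z, h1, h2⟩ := h
  exact ⟨-z, by simpa using h1, by simpa using h2⟩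

lemma exch {R : Type*} [Ring R]
    (hab : ∀ e : R, IsIdempotentElem e → ∀ r : R, e * r = r * e) {e a r : R}
    (he : IsIdempotentElem e) (h : e = a * r) : U e a := by
  have hc := hab e he
  have he' : e * e = e := he
  have hi : IsIdempotentElem (r * e * a) := by
    show (r * e * a) * (r * e * a) = r * e * a
    calc (r * e * a) * (r * e * a) = r * e * (a * r) * e * a := by noncomm_ring
      _ = r * (e * e * e) * a := by rw [← h]; noncomm_ring
      _ = _ := by rw [he', he']
  have hk := hab _ hi
  refine ⟨r, by rw [mul_assoc, ← h, he'], ?_⟩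
  have e1 : e * r * a = r * e * a := by rw [hc r]
  have e2 : e = (r * e * a) * e := by
    calc e = e * e * e := by rw [he', he']
      _ = (a * r) * e * (a * r) := by rw [← h]
      _ = a * (r * e * a) * r := by noncomm_ring
      _ = (r * e * a) * a * r := by rw [hk a]
      _ = (r * e * a) * (a * r) := by noncomm_ring
      _ = _ := by rw [← h]
  have e3 : (r * e * a) * e = r * e * a := by
    rw [mul_assoc, ← hc a, ← mul_assoc, mul_assoc r, he']
  rw [e1, ← e3, ← e2]

lemma nilp {S : Type*} [Ring S] {f B g : S} (hff : f * f = f) (hfB : f * B = B)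
    (hBf : B * f = B) (hfg : f * g = g * f)
    (hg : g * g = 1) (hBg : g * B = B * g) (h2 : B + B = 0) :
    (f + B + B * g) * (f + B + B * g) = f := by
  have h3 : B * g * f = B * g := by rw [mul_assoc, ← hfg, ← mul_assoc, hBf]
  have h4 : f * (B * g) = B * g := by rw [← mul_assoc, hfB]
  have h5 : B * (B * g) = B * B * g := by rw [mul_assoc]
  have h6 : B * g * B = B * B * g := by rw [mul_assoc, hBg, mul_assoc]
  have h7 : B * g * (B * g) = B * B := by
    rw [← mul_assoc, h6, mul_assoc, hg, mul_one]
  have h8 : B * B + B * B = 0 := by rw [← mul_add, h2, mul_zero]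
  have h9 : B * g + B * g = 0 := by rw [← add_mul, h2, zero_mul]
  have h10 : B * B * g + B * B * g = 0 := by rw [← add_mul, h8, zero_mul]
  calc _ = f * f + f * B + f * (B * g) + B * f + B * B + B * (B * g)
        + B * g * f + B * g * B + B * g * (B * g) := by noncomm_ring
    _ = f + (B + B) + (B * g + B * g) + (B * B + B * B) + (B * B * g + B * B * g) := by
      rw [hff, hfB, hBf, h3, h4, h5, h6, h7]; abel
    _ = f := by rw [h2, h8, h9, h10]; simp

section
variable {R S : Type*} [Ring R] [Ring S] (ι : R →+* S) (g : S)

lemma prodform (hg : g * g = 1) (hgc : ∀ r, g * ι r = ι r * g) (a b c d : R) :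
    (ι a + ι b * g) * (ι c + ι d * g) = ι (a * c + b * d) + ι (a * d + b * c) * g := by
  have h1 : ι b * g * ι c = ι b * ι c * g := by rw [mul_assoc, hgc, mul_assoc]
  have h2 : ι b * g * (ι d * g) = ι b * ι d := by
    rw [← mul_assoc, mul_assoc (ι b), hgc, mul_assoc, mul_assoc, hg, mul_one]
  calc _ = ι a * ι c + ι a * ι d * g + ι b * g * ι c + ι b * g * (ι d * g) := by noncomm_ring
    _ = _ := by rw [h1, h2]; simp only [map_add, map_mul]; noncomm_ring

lemma zsq (hg : g * g = 1) (hgc : ∀ r, g * ι r = ι r * g) {f A B : R} (hff : f * f = f)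
    (hfc : ∀ r, f * r = r * f) (hfB : f * B = B) (h1 : A + B = f) (h2 : A - B = f) :
    (ι A + ι B * g) * (ι A + ι B * g) = ι f := by
  have hB : B + B = 0 := by
    have : B + B = (A + B) - (A - B) := by abel
    rw [this, h1, h2, sub_self]
  have hA : A = f + B := by rw [← h2]; abel
  have := nilp (f := ι f) (B := ι B) (g := g) (by rw [← map_mul, hff]) (by rw [← map_mul, hfB])
    (by rw [← map_mul, ← hfc, hfB]) (hgc f).symm hg (hgc B) (by rw [← map_add, hB, map_zero])
  rw [hA, map_add]; exact this

lemma unit_rel (hg : g * g = 1) (hgc : ∀ r, g * ι r = ι r * g) {f a b : R} (hff : f * f = f)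
    (hfc : ∀ r, f * r = r * f) (hs : U f (a + b)) (hd : U f (a - b)) :
    U (ι f) (ι a + ι b * g) := by
  obtain ⟨p0, hp1, hp2⟩ := hs
  obtain ⟨q0, hq1, hq2⟩ := hd
  obtain ⟨p, hp⟩ : ∃ p, p = f * p0 := ⟨_, rfl⟩
  obtain ⟨q, hq⟩ : ∃ q, q = f * q0 := ⟨_, rfl⟩
  have fp : f * p = p := by rw [hp, ← mul_assoc, hff]
  have fq : f * q = q := by rw [hq, ← mul_assoc, hff]
  have sp : (a + b) * p = f := by rw [hp, ← mul_assoc, ← hfc, hp1]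
  have ps : p * (a + b) = f := by rw [hp, hp2]
  have dq : (a - b) * q = f := by rw [hq, ← mul_assoc, ← hfc, hq1]
  have qd : q * (a - b) = f := by rw [hq, hq2]
  obtain ⟨b', hb'⟩ : ∃ b', b' = -(p * b * q) := ⟨_, rfl⟩
  have hpq : p - q = b' + b' := by
    calc p - q = p * f - f * q := by rw [← hfc, fp, fq]
      _ = p * ((a - b) * q) - p * (a + b) * q := by rw [dq, ps]
      _ = _ := by rw [hb']; noncomm_ring
  have fb' : f * b' = b' := by
    rw [hb', mul_neg, ← mul_assoc, ← mul_assoc, fp]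
  obtain ⟨a', ha'⟩ : ∃ a', a' = p - b' := ⟨_, rfl⟩
  have hp' : a' + b' = p := by rw [ha']; abel
  have hq' : a' - b' = q := by
    have : q = p - (p - q) := by abel
    rw [this, hpq, ha']; abel
  have fa' : f * a' = a' := by rw [ha', mul_sub, fp, fb']
  have fl : ∀ c d, f * d = d → f * (c * d) = c * d := fun c d h => by
    rw [← mul_assoc, hfc, mul_assoc, h]
  have fr : ∀ c d, f * d = d → f * (d * c) = d * c := fun c d h => by
    rw [← mul_assoc, h]
  obtain ⟨x, hx⟩ : ∃ x, x = ι a + ι b * g := ⟨_, rfl⟩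
  obtain ⟨y, hy⟩ : ∃ y, y = ι a' + ι b' * g := ⟨_, rfl⟩
  have hxy : (x * y) * (x * y) = ι f := by
    rw [hx, hy, prodform ι g hg hgc]
    refine zsq ι g hg hgc hff hfc (by rw [mul_add, fl _ _ fb', fl _ _ fa']) ?_ ?_
    · rw [← sp, ← hp']; noncomm_ring
    · rw [← dq, ← hq']; noncomm_ring
  have hyx : (y * x) * (y * x) = ι f := by
    rw [hx, hy, prodform ι g hg hgc]
    refine zsq ι g hg hgc hff hfc (by rw [mul_add, fr _ _ fb', fr _ _ fa']) ?_ ?_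
    · rw [← ps, ← hp']; noncomm_ring
    · rw [← qd, ← hq']; noncomm_ring
  have ffy : ι f * y = y := by
    rw [hy, mul_add, ← mul_assoc, ← map_mul, ← map_mul, fa', fb']
  have hfx : ι f * x = x * ι f := by
    rw [hx, mul_add, add_mul, mul_assoc (ι b), hgc, ← mul_assoc, ← mul_assoc, ← map_mul,
      ← map_mul, ← map_mul, ← map_mul, hfc, hfc b]
  have hfy : ι f * y = y * ι f := by
    rw [hy, mul_add, add_mul, mul_assoc (ι b'), hgc, ← mul_assoc, ← mul_assoc, ← map_mul,
      ← map_mul, ← map_mul, ← map_mul, hfc, hfc b']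
  rw [← hx]
  have hF : ι f * ι f = ι f := by rw [← map_mul, hff]
  refine ⟨y * x * y, ?_, ?_⟩
  · rw [mul_assoc, show x * (y * x * y) = x * y * (x * y) by noncomm_ring, hxy, hF]
  · rw [mul_assoc, show y * x * y * x = y * x * (y * x) by noncomm_ring, hyx, hF]

/-- `x` is clean on the part cut out by `f`. -/
def Good (x : S) (f : R) : Prop := ∃ E, E * E = E ∧ U (ι f) (x - E)

lemma central (hgc : ∀ r, g * ι r = ι r * g) (hsurj : ∀ x : S, ∃ a b, x = ι a + ι b * g)
    {f : R} (hfc : ∀ r, f * r = r * f) (x : S) : ι f * x = x * ι f := by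
  obtain ⟨a, b, hx⟩ := hsurj x
  rw [hx, mul_add, add_mul, mul_assoc (ι b), hgc, ← mul_assoc, ← mul_assoc, ← map_mul,
      ← map_mul, ← map_mul, ← map_mul, hfc, hfc b]

lemma glue_mul {S : Type*} [Ring S] {e : S} (he : e * e = e) (hc : ∀ x, e * x = x * e)
    (a b c d : S) :
    (e * a + (1 - e) * b) * (e * c + (1 - e) * d) = e * (a * c) + (1 - e) * (b * d) := by
  have e1 : e * a * (e * c) = e * (a * c) := by
    rw [hc a, mul_assoc a, ← mul_assoc e e, he, ← mul_assoc, ← hc a, mul_assoc]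
  have e2 : e * a * (1 - e) = 0 := by
    rw [hc a, mul_assoc, mul_sub, he]; simp
  have e3 : (1 - e) * b * e = 0 := by
    rw [mul_assoc, ← hc b, ← mul_assoc, sub_mul, he]; simp
  have e4 : (1 - e) * b * (1 - e) = (1 - e) * b := by
    rw [mul_sub, e3]; simp
  calc _ = e * a * (e * c) + e * a * (1 - e) * d + (1 - e) * b * e * c
        + (1 - e) * b * (1 - e) * d := by noncomm_ring
    _ = _ := by rw [e1, e2, e3, e4]; noncomm_ring

lemma good_glue (hgc : ∀ r, g * ι r = ι r * g) (hsurj : ∀ x : S, ∃ a b, x = ι a + ι b * g)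
    {x : S} {f e : R} (he : e * e = e) (hec : ∀ r, e * r = r * e)
    (h1 : Good ι x (f * e)) (h2 : Good ι x (f * (1 - e))) : Good ι x f := by
  obtain ⟨E1, hE1, v1, h1a, h1b⟩ := h1
  obtain ⟨E2, hE2, v2, h2a, h2b⟩ := h2
  have hc := central ι g hgc hsurj hec
  have he' : ι e * ι e = ι e := by rw [← map_mul, he]
  simp only [map_mul, map_sub, map_one] at h1a h1b h2a h2b
  have hx : x - (ι e * E1 + (1 - ι e) * E2) = ι e * (x - E1) + (1 - ι e) * (x - E2) := by
    noncomm_ring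
  refine ⟨ι e * E1 + (1 - ι e) * E2, ?_, ι e * v1 + (1 - ι e) * v2, ?_, ?_⟩
  · rw [glue_mul he' hc, hE1, hE2]
  · rw [mul_assoc, hx, glue_mul he' hc]
    calc _ = ι f * ι e * (x - E1) * v1 + ι f * (1 - ι e) * (x - E2) * v2 := by noncomm_ring
      _ = _ := by rw [h1a, h2a]; noncomm_ring
  · rw [mul_assoc, hx, glue_mul he' hc]
    calc _ = ι f * ι e * v1 * (x - E1) + ι f * (1 - ι e) * v2 * (x - E2) := by noncomm_ring
      _ = _ := by rw [h1b, h2b]; noncomm_ring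

/-- Idempotent obtained from an inverse of two. -/
lemma half {f h : R} (hff : f * f = f) (hfc : ∀ r, f * r = r * f) (hh : f * 2 * h = f) :
    ∃ k : R, k + k = f ∧ f * k = k ∧ k * k + k * k = k := by
  have h2 : f * h + f * h = f := by
    rw [← hh]
    rw [hh]
    calc f * h + f * h = f * 2 * h := by noncomm_ring
      _ = f := hh
  have h3 : f * (f * h) = f * h := by rw [← mul_assoc, hff]
  refine ⟨f * h, h2, h3, ?_⟩
  rw [← mul_add, h2, ← hfc, h3]

lemma half_idem (hg : g * g = 1) (hgc : ∀ r, g * ι r = ι r * g) {k : R}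
    (hk : k * k + k * k = k) :
    (ι k + ι k * g) * (ι k + ι k * g) = ι k + ι k * g := by
  rw [prodform ι g hg hgc, hk]

/-- The case in which the sum is invertible and one may still have to split. -/
lemma case_two (hg : g * g = 1) (hgc : ∀ r, g * ι r = ι r * g) {f a b : R}
    (hff : f * f = f) (hfc : ∀ r, f * r = r * f) (h2 : U f 2)
    (hs : U f (a + b)) (hd : U f (1 - (a - b))) : Good ι (ι a + ι b * g) f := by
  obtain ⟨h, hh, -⟩ := h2
  obtain ⟨k, hk1, hk2, hk3⟩ := half hff hfc hh
  have hg' : (-g) * (-g) = 1 := by simpa using hg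
  have hgc' : ∀ r, (-g) * ι r = ι r * (-g) := fun r => by simpa using hgc r
  refine ⟨ι k + ι k * (-g), half_idem ι (-g) hg' hgc' hk3, ?_⟩
  have : ι a + ι b * g - (ι k + ι k * (-g)) = ι (a - k) + ι (b + k) * g := by
    simp only [map_sub, map_add]; noncomm_ring
  rw [this]
  refine unit_rel ι g hg hgc hff hfc ?_ ?_
  · rw [show a - k + (b + k) = a + b by abel]; exact hs
  · rw [show a - k - (b + k) = (a - b) - (k + k) by abel, hk1]
    obtain ⟨z, hz1, hz2⟩ := hd.neg
    have : f * (a - b - f) = f * -(1 - (a - b)) := by rw [mul_sub, hff]; noncomm_ring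
    have h' : f * -(1 - (a - b)) = f * (a - b - f) := this.symm
    refine ⟨z, by rw [this, hz1], ?_⟩
    rw [hfc z, mul_assoc, this, ← mul_assoc, ← hfc z, hz2]

lemma case_unit (hg : g * g = 1) (hgc : ∀ r, g * ι r = ι r * g) {f a b : R}
    (hff : f * f = f) (hfc : ∀ r, f * r = r * f)
    (hs : U f (a + b)) (hd : U f (a - b)) : Good ι (ι a + ι b * g) f :=
  ⟨0, by simp, by rw [sub_zero]; exact unit_rel ι g hg hgc hff hfc hs hd⟩

lemma good_compl {x : S} {f : R} (h : Good ι (1 - x) f) : Good ι x f := by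
  obtain ⟨E, hE, hu⟩ := h
  refine ⟨1 - E, ?_, ?_⟩
  · calc (1 - E) * (1 - E) = 1 - E - E + E * E := by noncomm_ring
      _ = 1 - E := by rw [hE]; abel
  · rw [show x - (1 - E) = -(1 - x - E) by abel]; exact hu.neg

lemma case_s (hg : g * g = 1) (hgc : ∀ r, g * ι r = ι r * g)
    (hsurj : ∀ x : S, ∃ a b, x = ι a + ι b * g)
    (hab : ∀ e : R, e * e = e → ∀ r : R, e * r = r * e)
    (hex : ∀ a : R, ∃ e : R, e * e = e ∧ U e a ∧ U (1 - e) (1 - a))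
    {f a b : R} (hff : f * f = f) (hs : U f (a + b)) : Good ι (ι a + ι b * g) f := by
  have idm : ∀ {e e' : R}, e * e = e → e' * e' = e' → (e * e') * (e * e') = e * e' := by
    intro e e' h h'
    rw [mul_assoc, ← mul_assoc e', ← hab e h e', mul_assoc, h', ← mul_assoc, h]
  have idc : ∀ {e : R}, e * e = e → (1 - e) * (1 - e) = 1 - e := by
    intro e h
    calc (1 - e) * (1 - e) = 1 - e - e + e * e := by noncomm_ring
      _ = 1 - e := by rw [h]; abel
  have hfc := hab f hff
  have Ur : ∀ {e y : R}, e * e = e → U e y → ∀ k, U (e * k) y := by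
    intro e y he h k
    rw [hab e he]; exact h.mul_left k
  obtain ⟨p, hp1, hp2⟩ := id hs
  -- split on d * p
  obtain ⟨e, he, hu, hv⟩ := hex ((a - b) * p)
  refine good_glue ι g hgc hsurj he (hab e he) ?_ ?_
  · -- d is invertible
    have hF := idm hff he
    have hFc := hab _ hF
    refine case_unit ι g hg hgc hF hFc (Ur hff hs e) ?_
    obtain ⟨z, hz1, hz2⟩ := hu.mul_left f
    obtain ⟨p', hp'1, hp'2⟩ : ∃ p', (f * e) * (a + b) * p' = f * e ∧
      (f * e) * p' * (a + b) = f * e := Ur hff hs e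
    -- right inverse p z; left inverse from z d p
    have hpF1 : (f * e) * p * (a + b) = f * e := by
      rw [hfc e]; rw [mul_assoc, mul_assoc, ← mul_assoc f, hp2]
    have hpF2 : (f * e) * (a + b) * p = f * e := by
      rw [hfc e]; rw [mul_assoc, mul_assoc, ← mul_assoc f, hp1]
    generalize f * e = F at *
    generalize a + b = s at *
    generalize a - b = d at *
    refine ⟨p * z, ?_, ?_⟩
    · calc F * d * (p * z) = F * (d * p) * z := by noncomm_ring
        _ = F := hz1
    · -- F p z d = F p z d (p s) = F p s = F
      calc F * (p * z) * d = p * z * d * F := by rw [hFc, mul_assoc, hFc d]; noncomm_ring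
        _ = p * z * d * (F * p * s) := by rw [hpF1]
        _ = p * (z * d * F) * p * s := by noncomm_ring
        _ = p * (F * z * d) * p * s := by rw [mul_assoc F, hFc (z * d)]
        _ = p * (F * z * (d * p)) * s := by noncomm_ring
        _ = F * p * s := by rw [hz2, hFc p]
        _ = F := hpF1
  · -- two is invertible
    have hF := idm hff (idc he)
    have hFc := hab _ hF
    have h2 : U (f * (1 - e)) 2 := by
      obtain ⟨z, hz1, hz2⟩ := hv.mul_left f
      have hpF2 : (f * (1 - e)) * (a + b) * p = f * (1 - e) := by
        rw [hfc (1 - e)]; rw [mul_assoc, mul_assoc, ← mul_assoc f, hp1]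
      generalize f * (1 - e) = F at *
      have key : F * (1 - (a - b) * p) = F * 2 * (b * p) := by
        calc F * (1 - (a - b) * p) = F - F * (a - b) * p := by noncomm_ring
          _ = F * (a + b) * p - F * (a - b) * p := by rw [hpF2]
          _ = _ := by noncomm_ring
      have k1 : F * 2 * (b * p * z) = F := by
        calc _ = F * 2 * (b * p) * z := by noncomm_ring
          _ = F := by rw [← key, hz1]
      refine ⟨b * p * z, k1, ?_⟩
      calc F * (b * p * z) * 2 = F * 2 * (b * p * z) := by noncomm_ring
        _ = F := k1
    have hs' := Ur hff hs (1 - e)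
    generalize f * (1 - e) = F at *
    obtain ⟨e', he', hu', hv'⟩ := hex (a - b)
    refine good_glue ι g hgc hsurj he' (hab e' he') ?_ ?_
    · exact case_unit ι g hg hgc (idm hF he') (hab _ (idm hF he')) (Ur hF hs' _)
        (hu'.mul_left F)
    · exact case_two ι g hg hgc (idm hF (idc he')) (hab _ (idm hF (idc he'))) (Ur hF h2 _)
        (Ur hF hs' _) (hv'.mul_left F)

lemma all_clean (hg : g * g = 1) (hgc : ∀ r, g * ι r = ι r * g)
    (hsurj : ∀ x : S, ∃ a b, x = ι a + ι b * g)
    (hab : ∀ e : R, e * e = e → ∀ r : R, e * r = r * e)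
    (hex : ∀ a : R, ∃ e : R, e * e = e ∧ U e a ∧ U (1 - e) (1 - a)) (x : S) :
    Good ι x (1 : R) := by
  obtain ⟨a, b, rfl⟩ := hsurj x
  obtain ⟨e, he, hu, hv⟩ := hex (a + b)
  refine good_glue ι g hgc hsurj he (hab e he) ?_ ?_
  · rw [one_mul]
    exact case_s ι g hg hgc hsurj hab hex he hu
  · rw [one_mul]
    apply good_compl
    have : 1 - (ι a + ι b * g) = ι (1 - a) + ι (-b) * g := by
      simp only [map_sub, map_neg, map_one]; noncomm_ring
    rw [this]
    refine case_s ι g hg hgc hsurj hab hex ?_ ?_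
    · calc (1 - e) * (1 - e) = 1 - e - e + e * e := by noncomm_ring
        _ = 1 - e := by rw [he]; abel
    · rw [show 1 - a + -b = 1 - (a + b) by abel]; exact hv

end

end CleanC2

open CleanC2 in
/-- If `R` is an Abelian exchange ring, then the group ring `R[ℤ/2ℤ]` is clean:
every element is the sum of an idempotent and a unit. -/
theorem monoidAlgebra_zmod_two_clean {R : Type*} [Ring R]
    (habelian : ∀ e : R, IsIdempotentElem e → ∀ r : R, e * r = r * e)
    (hexchange : ∀ a : R, ∃ e : R, IsIdempotentElem e ∧
      (∃ r : R, e = a * r) ∧ (∃ s : R, 1 - e = (1 - a) * s)) :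
    ∀ x : MonoidAlgebra R (Multiplicative (ZMod 2)),
      ∃ e u : MonoidAlgebra R (Multiplicative (ZMod 2)),
        IsIdempotentElem e ∧ IsUnit u ∧ x = e + u := by
  intro x
  have hex : ∀ a : R, ∃ e : R, e * e = e ∧ U e a ∧ U (1 - e) (1 - a) := by
    intro a
    obtain ⟨e, he, ⟨r, hr⟩, ⟨s, hs⟩⟩ := hexchange a
    exact ⟨e, he, exch habelian he hr, exch habelian he.one_sub hs⟩
  let ι : R →+* MonoidAlgebra R (Multiplicative (ZMod 2)) := MonoidAlgebra.singleOneRingHom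
  let t : Multiplicative (ZMod 2) := Multiplicative.ofAdd 1
  let g : MonoidAlgebra R (Multiplicative (ZMod 2)) := MonoidAlgebra.single t 1
  have hι : ∀ r, ι r = MonoidAlgebra.single 1 r := fun r => rfl
  have ht : t * t = 1 := by decide
  have hall : ∀ y : Multiplicative (ZMod 2), y = 1 ∨ y = t := by decide
  have hg : g * g = 1 := by
    simp only [g, MonoidAlgebra.single_mul_single, ht, mul_one, MonoidAlgebra.one_def]
  have hgc : ∀ r, g * ι r = ι r * g := by
    intro r
    simp only [g, hι, MonoidAlgebra.single_mul_single, mul_one, one_mul]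
  have hsurj : ∀ x, ∃ a b, x = ι a + ι b * g := by
    intro x
    induction x using MonoidAlgebra.induction_linear with
    | zero => exact ⟨0, 0, by simp⟩
    | add x y hx hy =>
      obtain ⟨a, b, rfl⟩ := hx
      obtain ⟨c, d, rfl⟩ := hy
      exact ⟨a + c, b + d, by simp only [map_add]; noncomm_ring⟩
    | single y r =>
      rcases hall y with rfl | rfl
      · exact ⟨r, 0, by simp [hι]⟩
      · exact ⟨0, r, by simp only [g, hι, MonoidAlgebra.single_mul_single]; simp⟩
  obtain ⟨E, hE, v, h1, h2⟩ := all_clean ι g hg hgc hsurj habelian hex x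
  simp only [map_one, one_mul] at h1 h2
  exact ⟨E, x - E, hE, ⟨⟨x - E, v, h1, h2⟩, rfl⟩, by abel⟩
end

section
/- If R is an Abelian exchange ring, then the group ring R[S₃] of the symmetric group on three letters over R is a clean ring: every element of R[S₃] is a sum of an idempotent and a unit. -/
namespace S3Clean

set_option linter.unusedSimpArgs false

/-- The corner `E A E` is a clean ring. -/
def CleanAt {A : Type*} [Ring A] (E : A) : Prop :=
  ∀ x : A, E * x = x → x * E = x → ∃ g u v : A, g * g = g ∧ E * g = g ∧ g * E = g ∧
    E * u = u ∧ u * E = u ∧ E * v = v ∧ v * E = v ∧ u * v = E ∧ v * u = E ∧ x = g + u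

theorem CleanAt.add {A : Type*} [Ring A] {e f : A} (he : e * e = e) (hf : f * f = f)
    (hef : e * f = 0) (hfe : f * e = 0) (ce : CleanAt e) (cf : CleanAt f) :
    CleanAt (e + f) := by
  intro x hx1 hx2
  have ex : ∀ z, e * (e * z) = e * z := fun z => by rw [← mul_assoc, he]
  have fx : ∀ z, f * (f * z) = f * z := fun z => by rw [← mul_assoc, hf]
  have efx : ∀ z, e * (f * z) = 0 := fun z => by rw [← mul_assoc, hef, zero_mul]
  have fex : ∀ z, f * (e * z) = 0 := fun z => by rw [← mul_assoc, hfe, zero_mul]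
  obtain ⟨g, u, v, gg, eg, ge, eu, ue, ev, ve, uv, vu, hx⟩ := ce (e * x * e)
    (by simp only [mul_assoc, he, ex]) (by simp only [mul_assoc, he])
  obtain ⟨b, hb⟩ : ∃ b, b = e * x * f := ⟨_, rfl⟩
  obtain ⟨c, hc⟩ : ∃ c, c = f * x * e := ⟨_, rfl⟩
  have eb : e * b = b := by rw [hb]; simp only [mul_assoc, ex]
  have bf : b * f = b := by rw [hb]; simp only [mul_assoc, hf]
  have fc : f * c = c := by rw [hc]; simp only [mul_assoc, fx]
  have ce' : c * e = c := by rw [hc]; simp only [mul_assoc, he]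
  obtain ⟨g', u', v', gg', fg', gf', fu', uf', fv', vf', uv', vu', hx'⟩ :=
    cf (f * x * f - c * v * b)
    (by rw [mul_sub, ← mul_assoc, ← mul_assoc, ← mul_assoc, ← mul_assoc, hf, fc])
    (by rw [sub_mul, mul_assoc _ b, bf, mul_assoc _ f, hf])
  have key : x = e * x * e + b + c + f * x * f := by
    calc x = (e + f) * x * (e + f) := by rw [hx1, hx2]
      _ = _ := by rw [hb, hc]; noncomm_ring
  -- zero products
  have z : ∀ {p q : A} {m n : A}, p * m = p → n * q = q → m * n = 0 → p * q = 0 := by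
    intro p q m n h1 h2 h3
    rw [← h1, ← h2, mul_assoc, ← mul_assoc m, h3, zero_mul, mul_zero]
  have za : ∀ {p q : A}, p * q = 0 → ∀ y, p * (q * y) = 0 := by
    intro p q h y
    rw [← mul_assoc, h, zero_mul]
  have ra : ∀ {p q w : A}, p * q = w → ∀ y, p * (q * y) = w * y := by
    intro p q w h y
    rw [← mul_assoc, h]
  refine ⟨g + g', u + b + c + (u' + c * v * b),
    (v + v * b * v' * c * v) - v * b * v' - v' * c * v + v', ?_, ?_, ?_, ?_, ?_, ?_, ?_, ?_, ?_, ?_⟩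
  · have h1 := z ge fg' hef
    have h2 := z gf' eg hfe
    simp only [mul_add, add_mul, gg, gg', h1, h2]; abel
  · have h1 := z he fg' hef
    have h2 := z hf eg hfe
    simp only [mul_add, add_mul, eg, fg', h1, h2]; abel
  · have h1 := z ge hf hef
    have h2 := z gf' he hfe
    simp only [mul_add, add_mul, ge, gf', h1, h2]; abel
  · have h1 := z he fu' hef
    have h2 := z hf eu hfe
    have h3 := z he fc hef
    have h4 := z hf eb hfe
    simp only [mul_add, add_mul, mul_assoc, eu, fu', eb, fc, h1, h2, h3, h4, za h3, ra fc]; abel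
  · have h1 := z ue hf hef
    have h2 := z uf' he hfe
    have h3 := z ce' hf hef
    have h4 := z bf he hfe
    simp only [mul_add, add_mul, mul_assoc, ue, uf', bf, ce', h1, h2, h3, h4, mul_zero]; abel
  · have h1 := z he fv' hef
    have h2 := z hf ev hfe
    simp only [mul_add, mul_sub, add_mul, mul_assoc, ev, fv', h1, h2, za h1, za h2, ra ev, ra fv']
    abel
  · have h1 := z ve hf hef
    have h2 := z vf' he hfe
    simp only [mul_add, add_mul, sub_mul, mul_assoc, ve, vf', h1, h2, mul_zero]
    abel
  · have h1 := z ue fv' hef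
    have h2 := z bf ev hfe
    have h3 := z ce' fv' hef
    have h4 := z uf' ev hfe
    simp only [mul_add, mul_sub, add_mul, mul_assoc, h1, h2, h3, h4, za h1, za h2, za h3, za h4,
      uv, uv', ra uv, ra uv', eb, ra eb, ra fc, fc, ra ce', mul_zero]
    abel
  · have h1 := z vf' eu hfe
    have h2 := z vf' eb hfe
    have h3 := z ve fc hef
    have h4 := z ve fu' hef
    have h5 := z ce' fc hef
    have h6 := z ce' fu' hef
    simp only [mul_add, sub_mul, add_mul, mul_assoc, h1, h2, h3, h4, za h1, za h2, za h3, za h4,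
      vu, vu', ra vu, ra vu', eb, ra eb, ra fc, fc, ra ce', ce', bf, ra bf, mul_zero]
    abel
  · have h3 : f * x * f = g' + u' + c * v * b := by rw [← hx']; abel
    rw [key, hx, h3]; abel

/-- `c` is invertible on the part of `R` where `g = 1`. -/
def Inv {R : Type*} [Ring R] (g c : R) : Prop := ∃ d, c * d = g ∧ d * c = g ∧ d * g = d


theorem inv_of_right {R : Type*} [Ring R] (hab : ∀ e : R, e * e = e → ∀ r : R, e * r = r * e)
    {g c r : R} (hg : g * g = g) (h : g = c * r) : Inv g c := by
  have cg := hab g hg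
  have h1 : c * (r * g) = g := by rw [← mul_assoc, ← h, hg]
  have h2 : (r * g * c) * (r * g * c) = r * g * c := by
    calc _ = r * g * (c * (r * g)) * c := by noncomm_ring
      _ = _ := by rw [h1, mul_assoc r, hg]
  refine ⟨r * g, h1, ?_, by rw [mul_assoc, hg]⟩
  have h3 := hab _ h2
  calc r * g * c = r * c * g := by rw [mul_assoc, cg, mul_assoc]
    _ = r * g * c * g := by rw [mul_assoc r g c, cg c, mul_assoc, mul_assoc, mul_assoc, hg]
    _ = r * g * c * (c * (r * g)) := by rw [h1]
    _ = c * (r * g * c) * (r * g) := by rw [← mul_assoc, h3 c]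
    _ = (c * (r * g)) * (c * (r * g)) := by noncomm_ring
    _ = g := by rw [h1, hg]

theorem Inv.mul {R : Type*} [Ring R] (hab : ∀ e : R, e * e = e → ∀ r : R, e * r = r * e)
    {g c k : R} (h : Inv g c) (hk : k * k = k) : Inv (g * k) c := by
  obtain ⟨d, h1, h2, h3⟩ := h
  have ck := hab k hk
  refine ⟨d * k, by rw [← mul_assoc, h1], by rw [mul_assoc, ck, ← mul_assoc, h2], ?_⟩
  rw [mul_assoc, ← mul_assoc k, ck g, mul_assoc g, hk, ← mul_assoc, h3]
theorem Inv.glue {R : Type*} [Ring R] (hab : ∀ e : R, e * e = e → ∀ r : R, e * r = r * e)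
    {g k x p q : R} (hg : g * g = g) (hk : k * k = k) (hgk : g * k = 0)
    (hp : g * p = p) (hq : k * q = q) (h1 : Inv g (x - p)) (h2 : Inv k (x - q)) :
    Inv (g + k) (x - (p + q)) := by
  obtain ⟨d, d1, d2, d3⟩ := h1
  obtain ⟨d', d1', d2', d3'⟩ := h2
  have cg := hab g hg
  have ck := hab k hk
  have hkg : k * g = 0 := by rw [← cg, hgk]
  have hp' : p * g = p := by rw [← cg, hp]
  have hq' : q * k = q := by rw [← ck, hq]
  have hd : g * d = d := by rw [cg, d3]
  have hd' : k * d' = d' := by rw [ck, d3']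
  have z : ∀ {p q : R} {m n : R}, p * m = p → n * q = q → m * n = 0 → p * q = 0 := by
    intro p q m n h1 h2 h3
    rw [← h1, ← h2, mul_assoc, ← mul_assoc m, h3, zero_mul, mul_zero]
  refine ⟨d + d', ?_, ?_, ?_⟩
  · have e1 : q * d = 0 := z hq' hd hkg
    have e2 : p * d' = 0 := z hp' hd' hgk
    calc _ = (x - p) * d + (x - q) * d' - q * d - p * d' := by noncomm_ring
      _ = _ := by rw [d1, d1', e1, e2]; simp
  · have e1 : d * q = 0 := z d3 hq hgk
    have e2 : d' * p = 0 := z d3' hp hkg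
    calc _ = d * (x - p) + d' * (x - q) - d * q - d' * p := by noncomm_ring
      _ = _ := by rw [d2, d2', e1, e2]; simp
  · have e1 : d * k = 0 := z d3 hk hgk
    have e2 : d' * g = 0 := z d3' hg hkg
    simp only [mul_add, add_mul, e1, e2, d3, d3']; simp

theorem Inv.one_sub {R : Type*} [Ring R] (hab : ∀ e : R, e * e = e → ∀ r : R, e * r = r * e)
    {g c : R} (hg : g * g = g) (h : Inv g (1 - c)) : Inv g (c - g) := by
  obtain ⟨d, d1, d2, d3⟩ := h
  have cg := hab g hg
  have hd : g * d = d := by rw [cg, d3]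
  refine ⟨-d, ?_, ?_, by rw [neg_mul, d3]⟩
  · calc _ = (1 - c) * d + g * d - d := by noncomm_ring
      _ = _ := by rw [d1, hd]; abel
  · calc _ = d * (1 - c) + d * g - d := by noncomm_ring
      _ = _ := by rw [d2, d3]; abel

/-- Local solution of the problem of cleaning `a + b j` (with `j ^ 2 = n j`). -/
def Sol {R : Type*} [Ring R] (n : ℕ) (a b g : R) : Prop :=
  ∃ α β : R, (∀ r, α * r = r * α) ∧ (∀ r, β * r = r * β) ∧ g * α = α ∧ g * β = β ∧
    α * α = α ∧ α * β + β * α + n * (β * β) = β ∧ Inv g (a - α) ∧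
    Inv g (a + n * b - (α + n * β))

theorem Sol.glue {R : Type*} [Ring R] (hab : ∀ e : R, e * e = e → ∀ r : R, e * r = r * e)
    {n : ℕ} {a b g k : R} (hg : g * g = g) (hk : k * k = k) (hgk : g * k = 0)
    (h1 : Sol n a b g) (h2 : Sol n a b k) : Sol n a b (g + k) := by
  obtain ⟨α, β, cα, cβ, gα, gβ, hα, hβ, i1, i2⟩ := h1
  obtain ⟨α', β', cα', cβ', gα', gβ', hα', hβ', i1', i2'⟩ := h2
  have cg := hab g hg
  have ck := hab k hk
  have hkg : k * g = 0 := by rw [← cg, hgk]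
  have z : ∀ {p q : R} {m n : R}, m * p = p → n * q = q → m * n = 0 → 
      (∀ r, m * r = r * m) → p * q = 0 := by
    intro p q m n h1 h2 h3 h4
    rw [← h1, ← h2, h4, mul_assoc, ← mul_assoc m, h3, zero_mul, mul_zero]
  have nc : ∀ m x : R, (∀ r, m * r = r * m) → m * x = x → m * (n * x) = n * x := by
    intro m x h1 h2
    rw [← mul_assoc, h1, mul_assoc, h2]
  refine ⟨α + α', β + β', ?_, ?_, ?_, ?_, ?_, ?_, ?_, ?_⟩
  · intro r; rw [add_mul, mul_add, cα, cα']
  · intro r; rw [add_mul, mul_add, cβ, cβ']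
  · simp only [add_mul, mul_add, gα, gα', z hg gα' hgk cg, z hk gα hkg ck]; simp
  · simp only [add_mul, mul_add, gβ, gβ', z hg gβ' hgk cg, z hk gβ hkg ck]; simp
  · simp only [add_mul, mul_add, hα, hα', z gα gα' hgk cg, z gα' gα hkg ck]; simp
  · refine Eq.trans ?_ (congrArg₂ (· + ·) hβ hβ')
    simp only [add_mul, mul_add, z gα gβ' hgk cg, z gα' gβ hkg ck,
      z gβ gα' hgk cg, z gβ' gα hkg ck, z gβ gβ' hgk cg, z gβ' gβ hkg ck, mul_zero, add_zero,
      zero_add]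
    abel
  · exact Inv.glue hab hg hk hgk gα gα' i1 i1'
  · have := Inv.glue hab hg hk hgk (p := α + n * β) (q := α' + n * β')
      (by rw [mul_add, gα, nc g β cg gβ]) (by rw [mul_add, gα', nc k β' ck gβ']) i2 i2'
    convert this using 2
    rw [mul_add]; abel

theorem sol_one {R : Type*} [Ring R] (hab : ∀ e : R, e * e = e → ∀ r : R, e * r = r * e)
    (hex : ∀ a : R, ∃ e : R, e * e = e ∧
      (∃ r : R, e = a * r) ∧ (∃ s : R, 1 - e = (1 - a) * s))
    (n : ℕ) (a b : R) : Sol n a b 1 := by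
  have comp : ∀ e : R, e * e = e → (1 - e) * (1 - e) = 1 - e := by
    intro e he
    calc _ = 1 - e - e + e * e := by noncomm_ring
      _ = _ := by rw [he]; abel
  have idm : ∀ e f : R, e * e = e → f * f = f → (e * f) * (e * f) = e * f := by
    intro e f he hf
    calc _ = e * (f * e) * f := by noncomm_ring
      _ = e * (e * f) * f := by rw [hab f hf e]
      _ = (e * e) * (f * f) := by noncomm_ring
      _ = _ := by rw [he, hf]
  have spl : ∀ c : R, ∃ e : R, e * e = e ∧ Inv e c ∧ Inv (1 - e) (1 - c) := by
    intro c
    obtain ⟨e, he, ⟨r, hr⟩, ⟨s, hs⟩⟩ := hex c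
    exact ⟨e, he, inv_of_right hab he hr, inv_of_right hab (comp e he) hs⟩
  -- splitting an idempotent
  have sp : ∀ g h : R, g * g = g → h * h = h → Sol n a b (g * h) → Sol n a b (g * (1 - h)) →
      Sol n a b g := by
    intro g h hg hh s1 s2
    have := Sol.glue hab (idm g h hg hh) (idm g _ hg (comp h hh)) (by
      calc g * h * (g * (1 - h)) = g * (h * g) * (1 - h) := by noncomm_ring
        _ = g * (g * h) * (1 - h) := by rw [hab h hh g]
        _ = g * g * (h - h * h) := by noncomm_ring
        _ = 0 := by rw [hh]; simp) s1 s2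
    rwa [show g * h + g * (1 - h) = g by noncomm_ring] at this
  -- both invertible
  have A : ∀ g : R, Inv g a → Inv g (a + n * b) → Sol n a b g := by
    intro g h1 h2
    exact ⟨0, 0, by simp, by simp, by simp, by simp, by simp, by simp, by simpa using h1,
      by simpa using h2⟩
  have cw : ∀ g : R, g * g = g → Inv g (n : R) →
      ∃ w : R, (∀ r, w * r = r * w) ∧ g * w = w ∧ n * w = g := by
    intro g hg ⟨w, w1, w2, w3⟩
    have cg := hab g hg
    refine ⟨w, ?_, by rw [cg, w3], w1⟩
    intro x
    calc w * x = w * x * g := by rw [mul_assoc, ← cg, ← mul_assoc, w3]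
      _ = w * (x * n) * w := by rw [← w1]; noncomm_ring
      _ = w * (n * x) * w := by rw [(Nat.cast_commute n x).eq]
      _ = (w * n) * x * w := by noncomm_ring
      _ = x * w := by rw [w2, cg, mul_assoc, cg, w3]
  obtain ⟨g1, hg1, i1, j1⟩ := spl a
  obtain ⟨g2, hg2, i2, j2⟩ := spl (a + n * b)
  have k1 := comp g1 hg1
  have k2 := comp g2 hg2
  have mulr : ∀ {g c k : R}, g * g = g → k * k = k → Inv k c → Inv (g * k) c := by
    intro g c k hg hk h
    rw [hab g hg]
    exact h.mul hab hg
  apply sp 1 g1 (by simp) hg1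
  · rw [one_mul]
    apply sp g1 g2 hg1 hg2
    · exact A _ (i1.mul hab hg2) (mulr hg1 hg2 i2)
    · obtain ⟨p', p1, p2, p3⟩ := i1
      have i1 : Inv g1 a := ⟨p', p1, p2, p3⟩
      obtain ⟨h, hh, ⟨r, hr⟩, ⟨s, hs⟩⟩ := hex ((a + n * b) * p')
      have hG := idm g1 (1 - g2) hg1 k2
      have l1 : Inv h (a + n * b) := inv_of_right hab hh (by rw [← mul_assoc]; exact hr)
      apply sp _ h hG hh
      · exact A _ ((i1.mul hab k2).mul hab hh) (mulr hG hh l1)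
      · have kh := comp h hh
        have hL : Inv (g1 * (1 - h)) (n : R) := by
          apply inv_of_right hab (idm _ _ hg1 kh) (r := -(g1 * (b * p' * s)))
          rw [hs, add_mul, p1]
          calc g1 * ((1 - (g1 + n * b * p')) * s)
              = (g1 - g1 * g1) * s - (g1 * n) * (b * p' * s) := by noncomm_ring
            _ = _ := by rw [hg1, ← (Nat.cast_commute n g1).eq]; noncomm_ring
        have hL' : Inv (g1 * (1 - g2) * (1 - h)) (n : R) := by
          have := hL.mul hab k2
          rwa [mul_assoc, hab _ kh, ← mul_assoc] at this
        have hg := idm _ _ hG kh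
        obtain ⟨w, w1, w2, w3⟩ := cw _ hg hL'
        refine ⟨0, w, by simp, w1, by simp, w2, by simp, ?_, ?_, ?_⟩
        · rw [← mul_assoc, w3, w2]; simp
        · rw [sub_zero]; exact (i1.mul hab k2).mul hab kh
        · rw [zero_add, w3]
          exact Inv.one_sub hab hg ((mulr hg1 k2 j2).mul hab kh)
  · rw [one_mul]
    apply sp (1 - g1) g2 k1 hg2
    · obtain ⟨p', p1, p2, p3⟩ := i2
      have i2 : Inv g2 (a + n * b) := ⟨p', p1, p2, p3⟩
      obtain ⟨h, hh, ⟨r, hr⟩, ⟨s, hs⟩⟩ := hex (a * p')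
      have hG := idm (1 - g1) g2 k1 hg2
      have l1 : Inv h a := inv_of_right hab hh (by rw [← mul_assoc]; exact hr)
      apply sp _ h hG hh
      · exact A _ (mulr hG hh l1) ((mulr k1 hg2 i2).mul hab hh)
      · have kh := comp h hh
        have hL : Inv (g2 * (1 - h)) (n : R) := by
          apply inv_of_right hab (idm _ _ hg2 kh) (r := (g2 * (b * p' * s)))
          rw [hs, show a * p' = g2 - n * (b * p') by rw [← p1]; noncomm_ring]
          calc g2 * ((1 - (g2 - n * (b * p'))) * s)
              = (g2 - g2 * g2) * s + (g2 * n) * (b * p' * s) := by noncomm_ring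
            _ = _ := by rw [hg2, ← (Nat.cast_commute n g2).eq]; noncomm_ring
        have hL' : Inv ((1 - g1) * g2 * (1 - h)) (n : R) := by
          have := mulr k1 (idm _ _ hg2 kh) hL
          rwa [← mul_assoc] at this
        have hg := idm _ _ hG kh
        obtain ⟨w, w1, w2, w3⟩ := cw _ hg hL'
        obtain ⟨g, hgd⟩ : ∃ g, g = (1 - g1) * g2 * (1 - h) := ⟨_, rfl⟩
        have q1 : Inv g (1 - a) := by rw [hgd]; exact (j1.mul hab hg2).mul hab kh
        have q2 : Inv g (a + n * b) := by rw [hgd]; exact (mulr k1 hg2 i2).mul hab kh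
        rw [← hgd] at hg w2 w3 ⊢
        refine ⟨g, -w, hab g hg, by simp [w1], hg, by simp [w2], hg, ?_, ?_, ?_⟩
        · rw [neg_mul_neg, ← mul_assoc, w3, mul_neg, neg_mul, w1, w2]; simp
        · exact Inv.one_sub hab hg q1
        · rw [mul_neg, w3, add_neg_cancel, sub_zero]
          exact q2
    · have hg := idm _ _ k1 k2
      have q1 := j1.mul hab k2
      have q2 := mulr k1 k2 j2
      refine ⟨_, 0, hab _ hg, by simp, hg, by simp, hg, by simp, Inv.one_sub hab hg q1, ?_⟩
      rw [mul_zero, add_zero]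
      exact Inv.one_sub hab hg q2

theorem cleanAt_corner {R A : Type*} [Ring R] [Ring A] (φ : R →+* A)
    (hab : ∀ e : R, e * e = e → ∀ r : R, e * r = r * e)
    (hex : ∀ a : R, ∃ e : R, e * e = e ∧
      (∃ r : R, e = a * r) ∧ (∃ s : R, 1 - e = (1 - a) * s))
    (n : ℕ) (E J : A) (cE : ∀ a, E * φ a = φ a * E) (cJ : ∀ a, J * φ a = φ a * J)
    (hE : E * E = E) (EJ : E * J = J) (JE : J * E = J) (JJ : J * J = φ n * J)
    (hs : ∀ x, ∃ a b, E * x * E = φ a * E + φ b * J) : CleanAt E := by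
  intro x hx1 hx2
  obtain ⟨a, b, hx⟩ := hs x
  rw [hx1, hx2] at hx
  obtain ⟨α, β, cα, cβ, -, -, hα, hβ, ⟨p, p1, p2, -⟩, ⟨q, q1, q2, -⟩⟩ := sol_one hab hex n a b
  have mulf : ∀ a b c d : R, (φ a * E + φ b * J) * (φ c * E + φ d * J) =
      φ (a * c) * E + φ (a * d + b * c + n * (b * d)) * J := by
    intro a b c d
    calc _ = φ a * (E * φ c) * E + φ a * (E * φ d) * J + φ b * (J * φ c) * E
          + φ b * (J * φ d) * J := by noncomm_ring
      _ = φ a * φ c * (E * E) + φ a * φ d * (E * J) + φ b * φ c * (J * E)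
          + φ b * φ d * (J * J) := by
            rw [cE, cE, cJ, cJ]; noncomm_ring
      _ = φ a * φ c * E + φ a * φ d * J + φ b * φ c * J
          + φ (b * d * n) * J := by rw [hE, EJ, JE, JJ, map_mul, map_mul]; noncomm_ring
      _ = _ := by
        rw [← (Nat.cast_commute n (b * d)).eq]
        simp only [map_add, map_mul, add_mul]; abel
  have Eone : E = φ 1 * E + φ 0 * J := by simp
  have El : ∀ a b, E * (φ a * E + φ b * J) = φ a * E + φ b * J := by
    intro a b
    rw [mul_add, ← mul_assoc, ← mul_assoc, cE, cE, mul_assoc, mul_assoc, hE, EJ]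
  have Er : ∀ a b, (φ a * E + φ b * J) * E = φ a * E + φ b * J := by
    intro a b
    rw [add_mul, mul_assoc, mul_assoc, hE, JE]
  obtain ⟨a', ha'⟩ : ∃ a', a' = a - α := ⟨_, rfl⟩
  obtain ⟨b', hb'⟩ : ∃ b', b' = b - β := ⟨_, rfl⟩
  have hq : a + n * b - (α + n * β) = a' + n * b' := by rw [ha', hb']; noncomm_ring
  rw [hq] at q1 q2
  rw [← ha'] at p1 p2
  have nb : ∀ x : R, x * n = n * x := fun x => ((Nat.cast_commute n x).eq).symm
  refine ⟨φ α * E + φ β * J, φ a' * E + φ b' * J, φ p * E + φ (-(q * b' * p)) * J,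
    ?_, El _ _, Er _ _, El _ _, Er _ _, El _ _, Er _ _, ?_, ?_, ?_⟩
  · rw [mulf, hα, hβ]
  · rw [mulf, p1]
    have : a' * -(q * b' * p) + b' * p + n * (b' * -(q * b' * p)) = 0 := by
      calc _ = b' * p - ((a' + n * b') * q) * (b' * p) := by noncomm_ring
        _ = 0 := by rw [q1]; noncomm_ring
    rw [this]; exact Eone.symm
  · have e : q * b' * p = p * b' * q := by
      have e1 : a' * q * b' = b' * q * a' := by
        have h1 : a' * q = 1 - n * b' * q := by rw [← q1]; noncomm_ring
        have h2 : q * a' = 1 - q * (n * b') := by rw [← q2]; noncomm_ring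
        rw [h1, mul_assoc b', h2]
        calc _ = b' - n * (b' * q * b') := by noncomm_ring
          _ = b' - (b' * q * b') * n := by rw [nb]
          _ = b' - (b' * q) * (b' * n) := by noncomm_ring
          _ = b' - (b' * q) * (n * b') := by rw [nb b']
          _ = _ := by noncomm_ring
      calc q * b' * p = (p * a') * q * b' * p := by rw [p2]; simp
        _ = p * (a' * q * b') * p := by noncomm_ring
        _ = p * b' * q * (a' * p) := by rw [e1]; noncomm_ring
        _ = _ := by rw [p1, mul_one]
    rw [mulf, p2]
    have : p * b' + -(q * b' * p) * a' + n * (-(q * b' * p) * b') = 0 := by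
      rw [e]
      calc _ = p * b' - p * b' * q * a' - (n * (p * b' * q)) * b' := by noncomm_ring
        _ = p * b' - p * b' * q * a' - ((p * b' * q) * n) * b' := by rw [nb]
        _ = p * b' - p * b' * (q * (a' + n * b')) := by noncomm_ring
        _ = 0 := by rw [q2]; noncomm_ring
    rw [this]; exact Eone.symm
  · rw [hx, ha', hb', map_sub, map_sub]; noncomm_ring

theorem cleanAt_group {R A : Type*} [Ring R] [Ring A] (φ : R →+* A)
    (hab : ∀ e : R, e * e = e → ∀ r : R, e * r = r * e)
    (hex : ∀ a : R, ∃ e : R, e * e = e ∧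
      (∃ r : R, e = a * r) ∧ (∃ s : R, 1 - e = (1 - a) * s))
    (r s : A) (cr : ∀ a, r * φ a = φ a * r) (cs : ∀ a, s * φ a = φ a * s)
    (hspan : ∀ x : A, ∃ a₁ a₂ a₃ a₄ a₅ a₆ : R, x = φ a₁ * 1 + φ a₂ * r + φ a₃ * (r * r)
      + φ a₄ * s + φ a₅ * (r * s) + φ a₆ * (r * (r * s)))
    (k n : ℕ) (t : R) (ct : ∀ a, t * a = a * t) (ht : k * t * t = t)
    (y J : A) (cy : ∀ a, y * φ a = φ a * y) (cJ : ∀ a, J * φ a = φ a * J)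
    (yy : y * y = k • y) (yJ : y * J = k • J) (Jy : J * y = k • J) (JJ : J * J = (k * n) • J)
    (m₁ m₂ m₃ m₄ m₅ m₆ l₁ l₂ l₃ l₄ l₅ l₆ : ℤ)
    (h₁ : y * 1 * y = m₁ • y + l₁ • J) (h₂ : y * r * y = m₂ • y + l₂ • J)
    (h₃ : y * (r * r) * y = m₃ • y + l₃ • J) (h₄ : y * s * y = m₄ • y + l₄ • J)
    (h₅ : y * (r * s) * y = m₅ • y + l₅ • J) (h₆ : y * (r * (r * s)) * y = m₆ • y + l₆ • J) :
    (φ t * y) * (φ t * y) = φ t * y ∧ CleanAt (φ t * y) := by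
  have gen : ∀ p q : A, (∀ a, p * φ a = φ a * p) →
      (φ t * p) * (φ t * q) = φ (t * t) * (p * q) := by
    intro p q hp
    calc _ = φ t * (p * φ t) * q := by noncomm_ring
      _ = _ := by rw [hp, map_mul]; noncomm_ring
  have kk : ∀ z : A, φ (t * t) * (k • z) = φ t * z := by
    intro z
    rw [nsmul_eq_mul, ← map_natCast φ k, ← mul_assoc, ← map_mul, ← (Nat.cast_commute k _).eq,
      ← mul_assoc, ht]
  have cc : ∀ p : A, (∀ a, p * φ a = φ a * p) → ∀ a, (φ t * p) * φ a = φ a * (φ t * p) := by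
    intro p hp a
    rw [mul_assoc, hp, ← mul_assoc, ← mul_assoc, ← map_mul, ct, map_mul]
  have hE : (φ t * y) * (φ t * y) = φ t * y := by rw [gen _ _ cy, yy, kk]
  refine ⟨hE, cleanAt_corner φ hab hex n (φ t * y) (φ t * J) (cc y cy) (cc J cJ) hE
    (by rw [gen _ _ cy, yJ, kk]) (by rw [gen _ _ cJ, Jy, kk]) ?_ ?_⟩
  · rw [gen _ _ cJ, JJ, mul_smul, kk, nsmul_eq_mul, map_natCast, ← mul_assoc, ← mul_assoc,
      (Nat.cast_commute n (φ t)).eq]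
  · have main : ∀ (a : R) (g : A) (m l : ℤ), g * φ t = φ t * g → y * g * y = m • y + l • J →
        (φ t * y) * (φ a * g) * (φ t * y) =
          φ (a * t * m) * (φ t * y) + φ (a * t * l) * (φ t * J) := by
      intro a g m l hg h
      have e1 : ∀ (m : ℤ) (z : A), φ (a * t * t) * (m • z) = φ (a * t * m) * (φ t * z) := by
        intro m z
        rw [zsmul_eq_mul, ← map_intCast φ m, ← mul_assoc, ← mul_assoc, ← map_mul, ← map_mul,
          mul_assoc _ (m : R) t, (Int.cast_commute m t).eq, mul_assoc (a * t) t]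
      calc (φ t * y) * (φ a * g) * (φ t * y) = φ t * (y * φ a) * g * (φ t * y) := by noncomm_ring
        _ = φ t * φ a * y * (g * φ t) * y := by rw [cy]; noncomm_ring
        _ = φ t * φ a * (y * φ t) * g * y := by rw [hg]; noncomm_ring
        _ = φ (t * a * t) * (y * g * y) := by rw [cy, map_mul, map_mul]; noncomm_ring
        _ = _ := by rw [h, ct a, mul_add, e1, e1]
    have c2 : r * r * φ t = φ t * (r * r) := by rw [mul_assoc, cr, ← mul_assoc, cr, mul_assoc]
    have c3 : r * s * φ t = φ t * (r * s) := by rw [mul_assoc, cs, ← mul_assoc, cr, mul_assoc]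
    have c4 : r * (r * s) * φ t = φ t * (r * (r * s)) := by
      rw [mul_assoc, c3, ← mul_assoc, cr, mul_assoc]
    intro x
    obtain ⟨a₁, a₂, a₃, a₄, a₅, a₆, hx⟩ := hspan x
    refine ⟨a₁ * t * m₁ + a₂ * t * m₂ + a₃ * t * m₃ + a₄ * t * m₄ + a₅ * t * m₅ + a₆ * t * m₆,
      a₁ * t * l₁ + a₂ * t * l₂ + a₃ * t * l₃ + a₄ * t * l₄ + a₅ * t * l₅ + a₆ * t * l₆, ?_⟩
    rw [hx]
    simp only [mul_add (φ t * y), add_mul _ _ (φ t * y), main a₁ _ _ _ (by simp) h₁, main a₂ _ _ _ (cr t) h₂,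
      main a₃ _ _ _ c2 h₃, main a₄ _ _ _ (cs t) h₄, main a₅ _ _ _ c3 h₅, main a₆ _ _ _ c4 h₆]
    simp only [map_add, add_mul]
    abel

theorem main_abstract {R A : Type*} [Ring R] [Ring A] (φ : R →+* A)
    (hab : ∀ e : R, e * e = e → ∀ r : R, e * r = r * e)
    (hex : ∀ a : R, ∃ e : R, e * e = e ∧
      (∃ r : R, e = a * r) ∧ (∃ s : R, 1 - e = (1 - a) * s))
    (r s : A) (cr : ∀ a, r * φ a = φ a * r) (cs : ∀ a, s * φ a = φ a * s)
    (hspan : ∀ x : A, ∃ a₁ a₂ a₃ a₄ a₅ a₆ : R, x = φ a₁ * 1 + φ a₂ * r + φ a₃ * (r * r)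
      + φ a₄ * s + φ a₅ * (r * s) + φ a₆ * (r * (r * s)))
    (hr : r * (r * r) = 1) (hs : s * s = 1) (hsr : s * r = r * (r * s)) :
    CleanAt (1 : A) := by
  have hr' : ∀ z, r * (r * (r * z)) = z := fun z => by
    rw [← mul_assoc r r z, ← mul_assoc, hr, one_mul]
  have hs' : ∀ z, s * (s * z) = z := fun z => by rw [← mul_assoc, hs, one_mul]
  have hsr' : ∀ z, s * (r * z) = r * (r * (s * z)) := fun z => by
    rw [← mul_assoc, hsr]; simp only [mul_assoc]
  have cr' : ∀ a z, r * (φ a * z) = φ a * (r * z) := fun a z => by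
    rw [← mul_assoc, cr, mul_assoc]
  have cs' : ∀ a z, s * (φ a * z) = φ a * (s * z) := fun a z => by
    rw [← mul_assoc, cs, mul_assoc]
  -- a central inverse of `k` on an idempotent
  have cw : ∀ (k : ℕ) (g r : R), g * g = g → g = k * r →
      ∃ w : R, (∀ r, w * r = r * w) ∧ g * w = w ∧ k * w = g := by
    intro k g r hg h
    obtain ⟨w, w1, w2, w3⟩ := inv_of_right hab hg h
    have cg := hab g hg
    refine ⟨w, ?_, by rw [cg, w3], w1⟩
    intro x
    calc w * x = w * x * g := by rw [mul_assoc, ← cg, ← mul_assoc, w3]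
      _ = w * (x * k) * w := by rw [← w1]; noncomm_ring
      _ = w * (k * x) * w := by rw [(Nat.cast_commute k x).eq]
      _ = (w * k) * x * w := by noncomm_ring
      _ = x * w := by rw [w2, cg, mul_assoc, cg, w3]
  obtain ⟨h, hh, ⟨r₀, hr₀⟩, ⟨s₀, hs₀⟩⟩ := hex 3
  have hh' : (1 - h) * (1 - h) = 1 - h := by
    calc _ = 1 - h - h + h * h := by noncomm_ring
      _ = _ := by rw [hh]; abel
  obtain ⟨t, ct, ht, ht3⟩ := cw 3 h r₀ hh (by exact_mod_cast hr₀)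
  obtain ⟨w, cw, hw, hw2⟩ := cw 2 (1 - h) (-s₀) hh' (by rw [hs₀]; push_cast; noncomm_ring)
  have key := cleanAt_group φ hab hex r s cr cs hspan
  have k1 : (φ t * (1 + r + r * r)) * (φ t * (1 + r + r * r)) = φ t * (1 + r + r * r) ∧
      CleanAt (φ t * (1 + r + r * r)) := by
    refine key 3 2 t ct (by rw [ht3, ht]) (1 + r + r * r) (1 + r + r * r + s + r * s + r * (r * s))
      ?_ ?_ ?_ ?_ ?_ ?_ (3) (3) (3) (-3) (-3) (-3) (0) (0) (0) (3) (3) (3)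
      ?_ ?_ ?_ ?_ ?_ ?_ <;> intros <;>
      simp only [mul_add, add_mul, mul_sub, sub_mul, mul_assoc, mul_one, one_mul, hr, hs, hsr,
        hr', hs', hsr', cr, cs, cr', cs', mul_zero, zero_mul, smul_zero, zero_smul, add_zero, sub_self] <;> abel
  have k2 : (φ t * (1 - r + s - r * (r * s))) * (φ t * (1 - r + s - r * (r * s))) = φ t * (1 - r + s - r * (r * s)) ∧
      CleanAt (φ t * (1 - r + s - r * (r * s))) := by
    refine key 3 0 t ct (by rw [ht3, ht]) (1 - r + s - r * (r * s)) (0)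
      ?_ ?_ ?_ ?_ ?_ ?_ (3) (0) (-3) (3) (0) (-3) (0) (0) (0) (0) (0) (0)
      ?_ ?_ ?_ ?_ ?_ ?_ <;> intros <;>
      simp only [mul_add, add_mul, mul_sub, sub_mul, mul_assoc, mul_one, one_mul, hr, hs, hsr,
        hr', hs', hsr', cr, cs, cr', cs', mul_zero, zero_mul, smul_zero, zero_smul, add_zero, sub_self] <;> abel
  have k3 : (φ t * (1 - r * r - s + r * (r * s))) * (φ t * (1 - r * r - s + r * (r * s))) = φ t * (1 - r * r - s + r * (r * s)) ∧
      CleanAt (φ t * (1 - r * r - s + r * (r * s))) := by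
    refine key 3 0 t ct (by rw [ht3, ht]) (1 - r * r - s + r * (r * s)) (0)
      ?_ ?_ ?_ ?_ ?_ ?_ (3) (-3) (0) (-3) (0) (3) (0) (0) (0) (0) (0) (0)
      ?_ ?_ ?_ ?_ ?_ ?_ <;> intros <;>
      simp only [mul_add, add_mul, mul_sub, sub_mul, mul_assoc, mul_one, one_mul, hr, hs, hsr,
        hr', hs', hsr', cr, cs, cr', cs', mul_zero, zero_mul, smul_zero, zero_smul, add_zero, sub_self] <;> abel
  have k4 : (φ w * (1 + s)) * (φ w * (1 + s)) = φ w * (1 + s) ∧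
      CleanAt (φ w * (1 + s)) := by
    refine key 2 3 w cw (by rw [hw2, hw]) (1 + s) (1 + r + r * r + s + r * s + r * (r * s))
      ?_ ?_ ?_ ?_ ?_ ?_ (2) (-1) (-1) (2) (-1) (-1) (0) (1) (1) (0) (1) (1)
      ?_ ?_ ?_ ?_ ?_ ?_ <;> intros <;>
      simp only [mul_add, add_mul, mul_sub, sub_mul, mul_assoc, mul_one, one_mul, hr, hs, hsr,
        hr', hs', hsr', cr, cs, cr', cs', mul_zero, zero_mul, smul_zero, zero_smul, add_zero, sub_self] <;> abel
  have k5 : (φ w * (1 - s)) * (φ w * (1 - s)) = φ w * (1 - s) ∧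
      CleanAt (φ w * (1 - s)) := by
    refine key 2 3 w cw (by rw [hw2, hw]) (1 - s) (1 + r + r * r - s - r * s - r * (r * s))
      ?_ ?_ ?_ ?_ ?_ ?_ (2) (-1) (-1) (-2) (1) (1) (0) (1) (1) (0) (-1) (-1)
      ?_ ?_ ?_ ?_ ?_ ?_ <;> intros <;>
      simp only [mul_add, add_mul, mul_sub, sub_mul, mul_assoc, mul_one, one_mul, hr, hs, hsr,
        hr', hs', hsr', cr, cs, cr', cs', mul_zero, zero_mul, smul_zero, zero_smul, add_zero, sub_self] <;> abel
  have hw0 : h * w = 0 := by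
    have : (1 - h) * w = w - h * w := by noncomm_ring
    rw [hw] at this
    have h2 : h * w = w - (w - h * w) := by abel
    rw [h2, ← this, sub_self]
  have tw : t * w = 0 := by rw [← ht, ← ct h, mul_assoc, hw0, mul_zero]
  have wt : w * t = 0 := by rw [← ct, tw]
  have gen : ∀ (a b : R) (p q : A), (∀ a, p * φ a = φ a * p) →
      (φ a * p) * (φ b * q) = φ (a * b) * (p * q) := by
    intro a b p q hp
    calc _ = φ a * (p * φ b) * q := by noncomm_ring
      _ = _ := by rw [hp, map_mul]; noncomm_ring
  have z1 : ∀ p q : A, (∀ a, p * φ a = φ a * p) → p * q = 0 → (φ t * p) * (φ t * q) = 0 := by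
    intro p q hp hq
    rw [gen _ _ _ _ hp, hq, mul_zero]
  have z2 : ∀ p q : A, (∀ a, p * φ a = φ a * p) → p * q = 0 → (φ w * p) * (φ w * q) = 0 := by
    intro p q hp hq
    rw [gen _ _ _ _ hp, hq, mul_zero]
  have z3 : ∀ p q : A, (∀ a, p * φ a = φ a * p) → (φ t * p) * (φ w * q) = 0 := by
    intro p q hp
    rw [gen _ _ _ _ hp, tw, map_zero, zero_mul]
  have z4 : ∀ p q : A, (∀ a, p * φ a = φ a * p) → (φ w * p) * (φ t * q) = 0 := by
    intro p q hp
    rw [gen _ _ _ _ hp, wt, map_zero, zero_mul]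
  have fin : φ t * (1 + r + r * r) + φ t * (1 - r + s - r * (r * s)) + φ t * (1 - r * r - s + r * (r * s))
      + (φ w * (1 + s) + φ w * (1 - s)) = 1 := by
    calc _ = φ t * 3 + φ w * 2 := by noncomm_ring
      _ = φ ((3 : ℕ) * t) + φ ((2 : ℕ) * w) := by
        rw [← ct, ← cw, map_mul, map_mul, map_natCast, map_natCast]; rfl
      _ = 1 := by rw [ht3, hw2, ← map_add]; simp
  obtain ⟨c, hc⟩ : ∃ c, c = 1 + r + r * r := ⟨_, rfl⟩
  obtain ⟨y, hy⟩ : ∃ c, c = 1 - r + s - r * (r * s) := ⟨_, rfl⟩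
  obtain ⟨y', hy'⟩ : ∃ c, c = 1 - r * r - s + r * (r * s) := ⟨_, rfl⟩
  obtain ⟨p, hp⟩ : ∃ c, c = 1 + s := ⟨_, rfl⟩
  obtain ⟨q, hq⟩ : ∃ c, c = 1 - s := ⟨_, rfl⟩
  have comm : (∀ a, c * φ a = φ a * c) ∧ (∀ a, y * φ a = φ a * y) ∧ (∀ a, y' * φ a = φ a * y') ∧
      (∀ a, p * φ a = φ a * p) ∧ (∀ a, q * φ a = φ a * q) := by
    rw [hc, hy, hy', hp, hq]
    refine ⟨?_, ?_, ?_, ?_, ?_⟩ <;> intros <;>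
      simp only [mul_add, add_mul, mul_sub, sub_mul, mul_assoc, mul_one, one_mul, hr, hs, hsr,
        hr', hs', hsr', cr, cs, cr', cs', mul_zero, zero_mul, smul_zero, zero_smul, add_zero, sub_self]
  have orth : c * y = 0 ∧ y * c = 0 ∧ c * y' = 0 ∧ y' * c = 0 ∧ y * y' = 0 ∧ y' * y = 0 ∧
      p * q = 0 ∧ q * p = 0 := by
    rw [hc, hy, hy', hp, hq]
    refine ⟨?_, ?_, ?_, ?_, ?_, ?_, ?_, ?_⟩ <;>
      simp only [mul_add, add_mul, mul_sub, sub_mul, mul_assoc, mul_one, one_mul, hr, hs, hsr,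
        hr', hs', hsr', cr, cs, cr', cs', mul_zero, zero_mul, smul_zero, zero_smul, add_zero, sub_self] <;> abel
  rw [← hc] at k1
  rw [← hy] at k2
  rw [← hy'] at k3
  rw [← hp] at k4
  rw [← hq] at k5
  rw [← hc, ← hy, ← hy', ← hp, ← hq] at fin
  obtain ⟨cc, cy, cy', cp, cq⟩ := comm
  obtain ⟨o1, o2, o3, o4, o5, o6, o7, o8⟩ := orth
  have s1 := CleanAt.add k1.1 k2.1 (z1 _ _ cc o1) (z1 _ _ cy o2) k1.2 k2.2
  have ids : ∀ {e f : A}, e * e = e → f * f = f → e * f = 0 → f * e = 0 →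
      (e + f) * (e + f) = e + f := by
    intro e f h1 h2 h3 h4
    simp only [mul_add, add_mul, h1, h2, h3, h4]; simp
  have i1 := ids k1.1 k2.1 (z1 _ _ cc o1) (z1 _ _ cy o2)
  have e1 : (φ t * c + φ t * y) * (φ t * y') = 0 := by
    rw [add_mul, z1 _ _ cc o3, z1 _ _ cy o5, add_zero]
  have e2 : (φ t * y') * (φ t * c + φ t * y) = 0 := by
    rw [mul_add, z1 _ _ cy' o4, z1 _ _ cy' o6, add_zero]
  have s2 := CleanAt.add i1 k3.1 e1 e2 s1 k3.2
  have i2 := ids i1 k3.1 e1 e2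
  have s3 := CleanAt.add k4.1 k5.1 (z2 _ _ cp o7) (z2 _ _ cq o8) k4.2 k5.2
  have i3 := ids k4.1 k5.1 (z2 _ _ cp o7) (z2 _ _ cq o8)
  have s4 := CleanAt.add i2 i3
    (by simp only [add_mul, mul_add, z3 _ _ cc, z3 _ _ cy, z3 _ _ cy', add_zero])
    (by simp only [add_mul, mul_add, z4 _ _ cp, z4 _ _ cq, add_zero]) s2 s3
  rwa [fin] at s4

end S3Clean

/-- If `R` is an Abelian exchange ring, then the group ring `R[S₃]` of the symmetric group
on three letters is clean: every element is the sum of an idempotent and a unit. -/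
theorem monoidAlgebra_symmGroupThree_clean {R : Type*} [Ring R]
    (habelian : ∀ e : R, IsIdempotentElem e → ∀ r : R, e * r = r * e)
    (hexchange : ∀ a : R, ∃ e : R, IsIdempotentElem e ∧
      (∃ r : R, e = a * r) ∧ (∃ s : R, 1 - e = (1 - a) * s)) :
    ∀ x : MonoidAlgebra R (Equiv.Perm (Fin 3)),
      ∃ e u : MonoidAlgebra R (Equiv.Perm (Fin 3)),
        IsIdempotentElem e ∧ IsUnit u ∧ x = e + u := by
  intro x
  obtain ⟨ρ, hρ⟩ : ∃ ρ : Equiv.Perm (Fin 3), ρ = finRotate 3 := ⟨_, rfl⟩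
  obtain ⟨σ, hσ⟩ : ∃ σ : Equiv.Perm (Fin 3), σ = Equiv.swap 0 1 := ⟨_, rfl⟩
  have h1 : ρ * (ρ * ρ) = 1 := by rw [hρ]; decide
  have h2 : σ * σ = 1 := by rw [hσ]; decide
  have h3 : σ * ρ = ρ * (ρ * σ) := by rw [hρ, hσ]; decide
  have hu : ∀ f : Equiv.Perm (Fin 3) → MonoidAlgebra R (Equiv.Perm (Fin 3)), ∑ g, f g =
      f 1 + f ρ + f (ρ * ρ) + f σ + f (ρ * σ) + f (ρ * (ρ * σ)) := by
    intro f
    have : (Finset.univ : Finset (Equiv.Perm (Fin 3))) =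
        {1, ρ, ρ * ρ, σ, ρ * σ, ρ * (ρ * σ)} := by rw [hρ, hσ]; decide
    rw [this, Finset.sum_insert (by rw [hρ, hσ]; decide),
      Finset.sum_insert (by rw [hρ, hσ]; decide), Finset.sum_insert (by rw [hρ, hσ]; decide),
      Finset.sum_insert (by rw [hρ, hσ]; decide), Finset.sum_insert (by rw [hρ, hσ]; decide),
      Finset.sum_singleton]
    abel
  have hm := S3Clean.main_abstract
    (MonoidAlgebra.singleOneRingHom (R := R) (M := Equiv.Perm (Fin 3))) habelian hexchange
    (MonoidAlgebra.single ρ 1) (MonoidAlgebra.single σ 1)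
    (by intro a; simp [MonoidAlgebra.single_mul_single])
    (by intro a; simp [MonoidAlgebra.single_mul_single])
    (by
      intro x
      refine ⟨x.coeff 1, x.coeff ρ, x.coeff (ρ * ρ), x.coeff σ, x.coeff (ρ * σ),
        x.coeff (ρ * (ρ * σ)), ?_⟩
      have hx : x = ∑ g, MonoidAlgebra.single g (x.coeff g) := by
        apply MonoidAlgebra.coeff_injective
        simp [MonoidAlgebra.coeff_sum, Finsupp.univ_sum_single]
      conv_lhs => rw [hx, hu]
      simp [MonoidAlgebra.single_mul_single, MonoidAlgebra.one_def])
    (by simp [MonoidAlgebra.single_mul_single, MonoidAlgebra.one_def, h1])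
    (by simp [MonoidAlgebra.single_mul_single, MonoidAlgebra.one_def, h2])
    (by simp [MonoidAlgebra.single_mul_single, h3])
  obtain ⟨e, u, v, he, -, -, -, -, -, -, uv, vu, hx⟩ := hm x (one_mul x) (mul_one x)
  exact ⟨e, u, he, ⟨⟨u, v, uv, vu⟩, rfl⟩, hx⟩
end

section
/- Let R be an Abelian exchange ring and let G be a group of prime order p. If p·1 lies in the Jacobson radical J(R) of R, then the group ring RG is clean: every element of RG is a sum of an idempotent and a unit. -/
open MonoidAlgebra in
/-- Left inverses modulo the Jacobson radical of the coefficient ring. -/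
theorem aux_left_inverse {R : Type*} [Ring R] {G : Type*} [Group G] [Finite G] {p : ℕ}
    (hpJ : (p : R) ∈ Ideal.jacobson (⊥ : Ideal R)) (w c : MonoidAlgebra R G)
    (v : MonoidAlgebra R G) (hv : v * w = 1 - (p : MonoidAlgebra R G) * c) :
    ∃ z, z * w = 1 := by
  let L : Submodule R (MonoidAlgebra R G) :=
    { carrier := {x | ∃ z, x = z * w}
      add_mem' := by
        rintro _ _ ⟨a, rfl⟩ ⟨b, rfl⟩
        exact ⟨a + b, by rw [add_mul]⟩
      zero_mem' := ⟨0, by simp⟩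
      smul_mem' := by
        rintro r _ ⟨a, rfl⟩
        exact ⟨r • a, by rw [smul_mul_assoc]⟩ }
  haveI : Module.Finite R (MonoidAlgebra R G) := by
    first
      | infer_instance
      | exact Module.Finite.equiv (MonoidAlgebra.coeffLinearEquiv R).symm
  have htop : L = ⊤ := by
    by_contra hL
    obtain ⟨M, hM, hLM⟩ := (eq_top_or_exists_le_coatom L).resolve_left hL
    apply hM.1
    rw [eq_top_iff]
    intro x _
    have h1 : x * (v * w) ∈ M := hLM ⟨x * v, by rw [mul_assoc]⟩
    have h2 : (p : R) • (x * c) ∈ M := by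
      have h3 : (p : R) • (x * c) ∈ Ring.jacobson R • (⊤ : Submodule R (MonoidAlgebra R G)) :=
        Submodule.smul_mem_smul (by rwa [← Ideal.jacobson_bot]) trivial
      have h4 := Ring.jacobson_smul_top_le R (MonoidAlgebra R G) h3
      exact (sInf_le (show M ∈ {m : Submodule R (MonoidAlgebra R G) | IsCoatom m} from hM)) h4
    have h5 : x = x * (v * w) + (p : R) • (x * c) := by
      rw [hv, Nat.cast_smul_eq_nsmul, nsmul_eq_mul, mul_sub, mul_one, ← mul_assoc, ← mul_assoc,
        (Nat.cast_commute p x).eq]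
      abel
    rw [h5]
    exact M.add_mem h1 h2
  have h1 : (1 : MonoidAlgebra R G) ∈ L := by rw [htop]; trivial
  obtain ⟨z, hz⟩ := h1
  exact ⟨z, hz.symm⟩

/-- Abelian exchange rings are clean. -/
theorem aux_clean {R : Type*} [Ring R]
    (habelian : ∀ e : R, IsIdempotentElem e → ∀ r : R, e * r = r * e)
    (hexchange : ∀ a : R, ∃ e : R, IsIdempotentElem e ∧
      (∃ r : R, e = a * r) ∧ (∃ s : R, 1 - e = (1 - a) * s)) (a : R) :
    ∃ e u : R, IsIdempotentElem e ∧ IsUnit u ∧ a = e + u := by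
  obtain ⟨e, he, ⟨r, hr⟩, ⟨s, hs⟩⟩ := hexchange a
  have hone : ∀ u v : R, u * v = 1 → IsUnit u := by
    intro u v huv
    have hf : IsIdempotentElem (v * u) := by
      unfold IsIdempotentElem
      rw [mul_assoc, ← mul_assoc u, huv, one_mul]
    have h1 : (v * u) * u = u := by
      rw [habelian _ hf u, ← mul_assoc, huv, one_mul]
    have h2 : v * u = 1 := by
      calc v * u = (v * u) * (u * v) := by rw [huv, mul_one]
        _ = ((v * u) * u) * v := by rw [mul_assoc, mul_assoc, mul_assoc]
        _ = 1 := by rw [h1, huv]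
    exact ⟨⟨u, v, huv, h2⟩, rfl⟩
  refine ⟨1 - e, a - (1 - e), he.one_sub, ?_, by abel⟩
  apply hone _ (r * e - s * (1 - e))
  have hee : e * e = e := he
  have e1 : a * (r * e) = e := by rw [← mul_assoc, ← hr, hee]
  have e2 : (1 - e) * (r * e) = 0 := by
    rw [← habelian e he r, ← mul_assoc, sub_mul, one_mul, hee, sub_self, zero_mul]
  have e3 : (1 - a) * (s * (1 - e)) = 1 - e := by
    rw [← mul_assoc, ← hs]; exact he.one_sub
  have e4 : e * (s * (1 - e)) = 0 := by
    rw [← mul_assoc, habelian e he s, mul_assoc, mul_sub, mul_one, hee, sub_self, mul_zero]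
  have key : (a - (1 - e)) * (r * e - s * (1 - e)) =
      a * (r * e) - (1 - e) * (r * e) + (1 - a) * (s * (1 - e)) - e * (s * (1 - e)) := by
    noncomm_ring
  rw [key, e1, e2, e3, e4]
  abel

/-- If `R` is an Abelian exchange ring and `G` is a group of prime order `p` with
`p·1 ∈ J(R)`, then the group ring `RG` is clean. -/
theorem monoidAlgebra_prime_order_clean {R : Type*} [Ring R] {G : Type*} [Group G]
    {p : ℕ} (hp : p.Prime) (hG : Nat.card G = p)
    (habelian : ∀ e : R, IsIdempotentElem e → ∀ r : R, e * r = r * e)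
    (hexchange : ∀ a : R, ∃ e : R, IsIdempotentElem e ∧
      (∃ r : R, e = a * r) ∧ (∃ s : R, 1 - e = (1 - a) * s))
    (hpJ : (p : R) ∈ Ideal.jacobson (⊥ : Ideal R)) :
    ∀ x : MonoidAlgebra R G, ∃ e u : MonoidAlgebra R G,
      IsIdempotentElem e ∧ IsUnit u ∧ x = e + u := by
  haveI : Fact p.Prime := ⟨hp⟩
  haveI : Finite G := Nat.finite_of_card_ne_zero (by rw [hG]; exact hp.ne_zero)
  haveI : Nontrivial G := by
    rw [← Finite.one_lt_card_iff_nontrivial, hG]; exact hp.one_lt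
  obtain ⟨g, hg⟩ := exists_ne (1 : G)
  have hgen : ∀ h : G, ∃ k : ℕ, g ^ k = h := fun h =>
    mem_powers_of_prime_card (g := g) (g' := h) hG hg
  have hgp : g ^ p = 1 := by rw [← hG]; exact pow_card_eq_one'
  let ε : MonoidAlgebra R G →+* R :=
    MonoidAlgebra.liftNCRingHom (RingHom.id R) (1 : G →* R) (fun x y => Commute.one_right x)
  have hε : ∀ (h : G) (r : R), ε (MonoidAlgebra.single h r) = r := by
    intro h r
    simp [ε]
  let ι : R →+* MonoidAlgebra R G := MonoidAlgebra.singleOneRingHom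
  have hι : ∀ r : R, ι r = MonoidAlgebra.single 1 r := fun r => rfl
  let γ : MonoidAlgebra R G := MonoidAlgebra.single g 1
  let t : MonoidAlgebra R G := γ - 1
  have hγpow : ∀ k : ℕ, γ ^ k = MonoidAlgebra.single (g ^ k) 1 := by
    intro k
    simp [γ, MonoidAlgebra.single_pow]
  -- every element is congruent to its augmentation modulo t
  have hdec : ∀ x : MonoidAlgebra R G, ∃ z, x = ι (ε x) + z * t := by
    intro x
    induction x using MonoidAlgebra.induction_linear with
    | zero => exact ⟨0, by simp⟩
    | add x y hx hy =>
      obtain ⟨a, ha⟩ := hx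
      obtain ⟨b, hb⟩ := hy
      refine ⟨a + b, ?_⟩
      rw [map_add, map_add, add_mul]
      nth_rewrite 1 [ha, hb]
      abel
    | single h r =>
      obtain ⟨k, rfl⟩ := hgen h
      refine ⟨ι r * ∑ i ∈ Finset.range k, γ ^ i, ?_⟩
      rw [hε, mul_assoc, geom_sum_mul, mul_sub, mul_one, hγpow, hι,
        MonoidAlgebra.single_mul_single]
      simp
  have htc : ∀ x : MonoidAlgebra R G, Commute t x := by
    intro x
    refine Commute.sub_left ?_ (Commute.one_left x)
    induction x using MonoidAlgebra.induction_linear with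
    | zero => exact Commute.zero_right _
    | add x y hx hy => exact hx.add_right hy
    | single h r =>
      obtain ⟨k, rfl⟩ := hgen h
      show γ * _ = _ * γ
      simp only [γ, MonoidAlgebra.single_mul_single, one_mul, mul_one]
      rw [(Commute.self_pow g k).eq]
  have htp : ∃ c, t ^ p = (p : MonoidAlgebra R G) * c := by
    obtain ⟨c, hc⟩ := (Commute.one_right t).exists_add_pow_prime_eq hp
    refine ⟨-(t * c), ?_⟩
    have h1 : t + 1 = γ := by simp [t]
    rw [h1, hγpow, hgp, one_pow, mul_one, ← MonoidAlgebra.one_def, mul_assoc] at hc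
    have h2 : t ^ p + (p : MonoidAlgebra R G) * (t * c) = 0 := by
      have := congrArg (fun y => y - 1) hc
      simp only [sub_self] at this
      rw [this]; abel
    rw [mul_neg]
    exact eq_neg_of_add_eq_zero_left h2
  obtain ⟨c, hc⟩ := htp
  have hεt : ε t = 0 := by
    simp only [t, γ, map_sub, hε, map_one, sub_self]
  have hleft : ∀ w, ε w = 1 → ∃ z, z * w = 1 := by
    intro w hw
    obtain ⟨z, hz⟩ := hdec w
    rw [hw, map_one] at hz
    have hy : (-(z * t)) ^ p = (p : MonoidAlgebra R G) * (c * (-z) ^ p) := by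
      rw [← neg_mul, ((htc (-z)).symm).mul_pow, ← mul_assoc, ← hc]
      exact (((htc (-z)).pow_pow p p).eq).symm
    apply aux_left_inverse hpJ w (c * (-z) ^ p) (∑ i ∈ Finset.range p, (-(z * t)) ^ i)
    rw [← hy, ← geom_sum_mul_neg, sub_neg_eq_add, ← hz]
  have hunit1 : ∀ w, ε w = 1 → IsUnit w := by
    intro w hw
    obtain ⟨z, hz⟩ := hleft w hw
    have hz1 : ε z = 1 := by
      have := congrArg ε hz
      rwa [map_mul, hw, mul_one, map_one] at this
    obtain ⟨y, hy⟩ := hleft z hz1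
    have : y = w := left_inv_eq_right_inv hy hz
    subst this
    exact ⟨⟨y, z, hy, hz⟩, rfl⟩
  have hunit : ∀ w, IsUnit (ε w) → IsUnit w := by
    rintro w ⟨u, hu⟩
    have h1 : IsUnit (ι (↑u⁻¹ : R)) := (Units.isUnit _).map ι
    have h2 : IsUnit (ι (↑u⁻¹ : R) * w) := by
      apply hunit1
      rw [map_mul, ← hu, hι, hε, Units.inv_mul]
    exact (h1.mul_left_iff).1 h2
  intro x
  obtain ⟨e, u, he, hu, hx⟩ := aux_clean habelian hexchange (ε x)
  refine ⟨ι e, x - ι e, he.map ι, ?_, by abel⟩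
  apply hunit
  rw [map_sub, hx, hι, hε, add_sub_cancel_left]
  exact hu
end

section
/- Let R be a local ring, p a prime number with p·1 ∈ J(R), and let G be a locally finite p-group (every element of G has order a power of p and every finitely generated subgroup of G is finite). Then the group ring RG is a local ring. -/
/-- A finite `p`-group acting on a nonzero `p`-torsion abelian group has a nonzero fixed point. -/
theorem exists_fixed_of_torsion {p : ℕ} (hp : p.Prime) {G : Type*} [Group G] [Finite G]
    (hpG : IsPGroup p G) {S : Type*} [AddCommGroup S] [DistribMulAction G S]
    [Module (ZMod p) S]
    (hS : ∀ s : S, p • s = 0) (x : S) (hx : x ≠ 0) : ∃ y : S, y ≠ 0 ∧ ∀ g : G, g • y = y := by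
  have : Fact p.Prime := ⟨hp⟩
  let N : Submodule (ZMod p) S := Submodule.span (ZMod p) (Set.range fun g : G => g • x)
  have hN : ∀ (g : G) (y : S), y ∈ N → g • y ∈ N := by
    intro g y hy
    have hle : N ≤ N.comap ((DistribMulAction.toAddMonoidHom S g).toZModLinearMap p) := by
      refine Submodule.span_le.2 ?_
      rintro _ ⟨h, rfl⟩
      refine Submodule.subset_span ⟨g * h, ?_⟩
      exact mul_smul g h x
    exact hle hy
  let _ : MulAction G N :=
    { smul := fun g y => ⟨g • (y : S), hN g y y.2⟩
      one_smul := fun y => Subtype.ext (one_smul G (y : S))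
      mul_smul := fun g h y => Subtype.ext (mul_smul g h (y : S)) }
  have hfin : Module.Finite (ZMod p) N := Module.Finite.span_of_finite _ (Set.finite_range _)
  have : Finite N := Module.finite_of_finite (ZMod p)
  have hxN : x ∈ N := Submodule.subset_span ⟨1, one_smul G x⟩
  have hdvd : p ∣ Nat.card N := by
    have h1 : addOrderOf (⟨x, hxN⟩ : N) = p :=
      addOrderOf_eq_prime (Subtype.ext (hS x)) (fun h => hx (congrArg Subtype.val h))
    have h2 := addOrderOf_dvd_natCard (⟨x, hxN⟩ : N)
    rwa [h1] at h2
  obtain ⟨y, hy, hy0⟩ := hpG.exists_fixed_point_of_prime_dvd_card_of_fixed_point N hdvd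
    (a := 0) (fun g => Subtype.ext (smul_zero g))
  exact ⟨y, fun h => hy0 (Subtype.ext h.symm), fun g => congrArg Subtype.val (hy g)⟩

/-- The augmentation map. -/
noncomputable def augm (R G : Type*) [Ring R] [Group G] : MonoidAlgebra R G →+* R :=
  MonoidAlgebra.liftNCRingHom (RingHom.id R) (1 : G →* R) (fun x _ => Commute.one_right x)

theorem augm_single {R G : Type*} [Ring R] [Group G] (g : G) (r : R) :
    augm R G (MonoidAlgebra.single g r) = r := by
  simp [augm]

theorem span_eq_top_of_augm {R : Type*} [Ring R]
    {p : ℕ} (hp : p.Prime) (hpJ : (p : R) ∈ Ideal.jacobson (⊥ : Ideal R))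
    {G : Type*} [Group G] [Finite G] (hpG : IsPGroup p G)
    (a : MonoidAlgebra R G) (ha : IsUnit (augm R G a)) :
    Ideal.span {a} = (⊤ : Ideal (MonoidAlgebra R G)) := by
  by_contra hne
  obtain ⟨m, hm, ham⟩ := Ideal.exists_le_maximal _ hne
  have ham : a ∈ m := ham (Ideal.subset_span rfl)
  have hRfin : Module.Finite R (MonoidAlgebra R G) :=
    Module.Finite.equiv (MonoidAlgebra.coeffLinearEquiv R (S := R) (M := G)).symm
  let S := MonoidAlgebra R G ⧸ m
  have hsimple : IsSimpleModule (MonoidAlgebra R G) S :=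
    isSimpleModule_iff_isCoatom.2 (Ideal.isMaximal_def.1 hm)
  have hnt : Nontrivial S := IsSimpleModule.nontrivial (MonoidAlgebra R G) S
  have hSfin : Module.Finite R S :=
    Module.Finite.of_surjective (m.mkQ.restrictScalars R) m.mkQ_surjective
  have hsmul : ∀ (r : R) (s : S), r • s = (MonoidAlgebra.single (1 : G) r) • s := by
    intro r s
    obtain ⟨b, rfl⟩ := m.mkQ_surjective s
    have h : r • b = MonoidAlgebra.single (1 : G) r * b := by
      ext g
      simp
    change m.mkQ (r • b) = m.mkQ (MonoidAlgebra.single (1 : G) r * b)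
    rw [h]
  -- `p` kills `S`
  have hpS : ∀ s : S, p • s = 0 := by
    let f : S →ₗ[MonoidAlgebra R G] S := p • LinearMap.id
    rcases eq_bot_or_eq_top (LinearMap.range f) with h | h
    · intro s
      have : f s ∈ LinearMap.range f := ⟨s, rfl⟩
      rw [h] at this
      exact this
    · exfalso
      have hlt := Submodule.jacobson_smul_lt_top (R := R) (M := S) ⊤
      refine hlt.not_ge ?_
      intro s _
      have : s ∈ LinearMap.range f := h ▸ Submodule.mem_top
      obtain ⟨t, rfl⟩ := this
      have : f t = (p : R) • t := (Nat.cast_smul_eq_nsmul R p t).symm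
      rw [this]
      refine Submodule.smul_mem_smul ?_ Submodule.mem_top
      rwa [← Ideal.jacobson_bot]
  let _ : DistribMulAction G S := DistribMulAction.compHom S (MonoidAlgebra.of R G)
  obtain ⟨x, hx⟩ := exists_ne (0 : S)
  let _ : Module (ZMod p) S := AddCommGroup.zmodModule hpS
  obtain ⟨y, hy0, hy⟩ := exists_fixed_of_torsion hp hpG hpS x hx
  have hy : ∀ g : G, (MonoidAlgebra.single g (1 : R)) • y = y := hy
  have key : ∀ b : MonoidAlgebra R G, b • y = augm R G b • y := by
    intro b
    induction b using MonoidAlgebra.induction_linear with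
    | zero => simp
    | add b c hb hc => rw [add_smul, hb, hc, map_add, add_smul]
    | single g r =>
      have : MonoidAlgebra.single g r
          = MonoidAlgebra.single (1 : G) r * MonoidAlgebra.single g (1 : R) := by
        simp
      rw [augm_single, this, mul_smul, hy, hsmul]
  obtain ⟨b, hb⟩ := IsSimpleModule.toSpanSingleton_surjective (MonoidAlgebra R G) hy0 (m.mkQ 1)
  have hb : b • y = m.mkQ 1 := hb
  have h0 : a • m.mkQ 1 = 0 := by
    rw [← map_smul, smul_eq_mul, mul_one]
    exact (Submodule.Quotient.mk_eq_zero m).2 ham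
  rw [← hb, ← mul_smul, key, map_mul, mul_smul, ← key, hb] at h0
  have h1 : m.mkQ 1 = 0 := ha.smul_eq_zero.1 h0
  exact hm.ne_top ((Ideal.eq_top_iff_one m).2 ((Submodule.Quotient.mk_eq_zero m).1 h1))

theorem isUnit_of_augm_finite {R : Type*} [Ring R]
    {p : ℕ} (hp : p.Prime) (hpJ : (p : R) ∈ Ideal.jacobson (⊥ : Ideal R))
    {G : Type*} [Group G] [Finite G] (hpG : IsPGroup p G)
    (a : MonoidAlgebra R G) (ha : IsUnit (augm R G a)) : IsUnit a := by
  have left : ∀ a : MonoidAlgebra R G, IsUnit (augm R G a) →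
      ∃ b, b * a = 1 ∧ IsUnit (augm R G b) := by
    intro a ha
    have h := span_eq_top_of_augm hp hpJ hpG a ha
    obtain ⟨b, hb⟩ := Ideal.mem_span_singleton'.1 ((Ideal.eq_top_iff_one _).1 h)
    refine ⟨b, hb, ?_⟩
    have h2 : augm R G b * augm R G a = 1 := by rw [← map_mul, hb, map_one]
    obtain ⟨u, hu⟩ := ha
    rw [← hu] at h2
    have h3 : augm R G b = ↑u⁻¹ := by
      rw [← mul_one (↑u⁻¹ : R)]
      calc augm R G b = (augm R G b * u) * ↑u⁻¹ := by simp
        _ = ↑u⁻¹ * 1 := by rw [h2]; simp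
    rw [h3]
    exact Units.isUnit _
  obtain ⟨b, hb, hbu⟩ := left a ha
  obtain ⟨c, hc, -⟩ := left b hbu
  have : c = a := left_inv_eq_right_inv hc hb
  subst this
  exact ⟨⟨c, b, hc, hb⟩, rfl⟩

theorem isUnit_of_augm {R : Type*} [Ring R]
    {p : ℕ} (hp : p.Prime) (hpJ : (p : R) ∈ Ideal.jacobson (⊥ : Ideal R))
    {G : Type*} [Group G] (hpG : IsPGroup p G)
    (hLF : ∀ s : Finset G, Finite (Subgroup.closure (s : Set G)))
    (a : MonoidAlgebra R G) (ha : IsUnit (augm R G a)) : IsUnit a := by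
  let H := Subgroup.closure (a.coeff.support : Set G)
  have : Finite H := hLF _
  let φ := MonoidAlgebra.mapDomainRingHom R H.subtype
  have hφ : ∀ b, augm R G (φ b) = augm R H b := by
    intro b
    induction b using MonoidAlgebra.induction_linear with
    | zero => simp
    | add b c hb hc => rw [map_add, map_add, hb, hc, map_add]
    | single g r => simp [φ, augm_single]
  have hmem : a ∈ φ.range := by
    have hsum : a = ∑ g ∈ a.coeff.support, MonoidAlgebra.single g (a.coeff g) := by
      exact (MonoidAlgebra.sum_coeff_single a).symm
    rw [hsum]
    refine Subring.sum_mem _ fun g hg => ?_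
    refine ⟨MonoidAlgebra.single ⟨g, Subgroup.subset_closure hg⟩ (a.coeff g), ?_⟩
    simp [φ]
  obtain ⟨b, hb⟩ := hmem
  rw [← hb, hφ] at ha
  rw [← hb]
  exact (isUnit_of_augm_finite hp hpJ (hpG.to_subgroup H) b ha).map φ

/-- If `R` is a local ring, `p` is a prime with `p·1 ∈ J(R)`, and `G` is a locally finite
`p`-group, then the group ring `RG` is local. -/
theorem monoidAlgebra_isLocalRing {R : Type*} [Ring R] [IsLocalRing R]
    {p : ℕ} (hp : p.Prime) (hpJ : (p : R) ∈ Ideal.jacobson (⊥ : Ideal R))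
    {G : Type*} [Group G] (hpG : IsPGroup p G)
    (hLF : ∀ s : Finset G, Finite (Subgroup.closure (s : Set G))) :
    IsLocalRing (MonoidAlgebra R G) := by
  have : Nontrivial (MonoidAlgebra R G) := (augm R G).domain_nontrivial
  refine ⟨fun {a b} h => ?_⟩
  have h2 : augm R G a + augm R G b = 1 := by rw [← map_add, h, map_one]
  exact (IsLocalRing.isUnit_or_isUnit_of_add_one h2).imp
    (isUnit_of_augm hp hpJ hpG hLF a) (isUnit_of_augm hp hpJ hpG hLF b)
end

section
/- Let R be a semiperfect ring, i.e., R/J(R) is a semisimple ring and idempotents of R/J(R) lift to idempotents of R. Then the group ring R[S₃] of the symmetric group on three letters over R is semiperfect. -/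
/-- A ring `R` is *semiperfect* if `R/J(R)` is semisimple and every idempotent of `R/J(R)`
lifts to an idempotent of `R`.  Here the Jacobson radical is realized as the two-sided
ideal whose underlying set is `Ideal.jacobson ⊥`, and `R/J(R)` is the quotient by the
associated ring congruence. -/
def IsSemiperfectRing (R : Type*) [Ring R] : Prop :=
  ∃ J : TwoSidedIdeal R, (∀ x : R, x ∈ J ↔ x ∈ Ideal.jacobson (⊥ : Ideal R)) ∧
    IsSemisimpleRing J.ringCon.Quotient ∧
    ∀ e : J.ringCon.Quotient, IsIdempotentElem e →
      ∃ a : R, IsIdempotentElem a ∧ J.ringCon.mk' a = e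


namespace SPS

/-- `e` is idempotent and every non-radical element of `S e` generates `S e`. -/
def Loc {S : Type*} [Ring S] (e : S) : Prop :=
  e * e = e ∧ ∀ x : S, x * e ∉ Ideal.jacobson (⊥ : Ideal S) → ∃ w, w * (x * e) = e

/-- `f` is a finite orthogonal sum of local idempotents. -/
inductive Dec {S : Type*} [Ring S] : S → Prop
  | zero : Dec 0
  | add (e f : S) : Loc e → Dec f → e * f = 0 → f * e = 0 → Dec (e + f)

lemma Dec.sum {S : Type*} [Ring S] {e f : S} (he : Dec e) (hf : Dec f) (h1 : e * f = 0)
    (h2 : f * e = 0) : Dec (e + f) := by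
  induction he with
  | zero => simpa using hf
  | add a b ha hb hab hba ih =>
    have h3 : a * f = 0 := by
      have : a * ((a + b) * f) = 0 := by rw [h1, mul_zero]
      rw [← mul_assoc, mul_add, ha.1, hab, add_zero] at this
      exact this
    have h4 : f * a = 0 := by
      have : (f * (a + b)) * a = 0 := by rw [h2, zero_mul]
      rw [mul_assoc, add_mul, ha.1, hba, add_zero] at this
      exact this
    have h5 : b * f = 0 := by rwa [add_mul, h3, zero_add] at h1
    have h6 : f * b = 0 := by rwa [mul_add, h4, zero_add] at h2
    rw [add_assoc]
    exact Dec.add a _ ha (ih h5 h6) (by rw [mul_add, hab, h3, add_zero])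
      (by rw [add_mul, hba, h4, add_zero])

lemma Loc.dec {S : Type*} [Ring S] {e : S} (he : Loc e) : Dec e := by
  simpa using Dec.add e 0 he Dec.zero (by simp) (by simp)

lemma exists_linv {S : Type*} [Ring S] {j : S} (hj : j ∈ Ideal.jacobson (⊥ : Ideal S)) :
    ∃ z, z * (1 + j) = 1 := by
  obtain ⟨z, hz⟩ := Ideal.mem_jacobson_iff.1 hj 1
  refine ⟨z, ?_⟩
  rw [Ideal.mem_bot, sub_eq_zero, mul_one] at hz
  rw [mul_add, mul_one, add_comm, hz]

lemma exists_inv {S : Type*} [Ring S] {j : S} (hj : j ∈ Ideal.jacobson (⊥ : Ideal S)) :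
    ∃ z, z * (1 + j) = 1 ∧ (1 + j) * z = 1 := by
  obtain ⟨z, hz⟩ := exists_linv hj
  obtain ⟨y, hy⟩ := exists_linv (j := - (z * j)) (neg_mem (Ideal.mul_mem_left _ _ hj))
  have h : 1 + -(z * j) = z := by
    rw [← hz]; noncomm_ring
  rw [h] at hy
  have : y = 1 + j := by
    calc y = y * (z * (1 + j)) := by rw [hz, mul_one]
      _ = 1 + j := by rw [← mul_assoc, hy, one_mul]
  exact ⟨z, hz, this ▸ hy⟩

lemma idem_mem {S : Type*} [Ring S] {e : S} (he : e * e = e)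
    (hj : e ∈ Ideal.jacobson (⊥ : Ideal S)) : e = 0 := by
  obtain ⟨z, hz⟩ := exists_linv (neg_mem hj)
  calc e = z * (1 + -e) * e := by rw [hz, one_mul]
    _ = z * (e - e * e) := by noncomm_ring
    _ = 0 := by rw [he, sub_self, mul_zero]

lemma semisimple_bot {T : Type*} [Ring T] : IsSemisimpleModule T (⊥ : Ideal T) :=
  (isSemisimpleModule_iff _ _).mpr Subsingleton.instComplementedLattice

section lift
variable {S T : Type*} [Ring S] [Ring T] (p : S →+* T)

/-- Same right-annihilator data: exchange lifting. -/
lemma lift_exchange (hp : Function.Surjective p) (e : T) (he : e * e = e) (K : S) (hK : K * K = K)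
    (hint : ∀ x y, x * e = y * p K → x * e = 0) (x y : T) (h1 : 1 = x * e + y * p K) :
    ∃ a : S, a * a = a ∧ p a = e := by
  have hk : p K * p K = p K := by rw [← map_mul, hK]
  set k := p K with hkdef
  have hee : e * x * e = e := by
    have h : (1 - e * x) * e = (e * y) * k := by
      calc (1 - e * x) * e = e * 1 - e * x * e := by noncomm_ring
        _ = _ := by rw [h1]; noncomm_ring
    have := hint _ _ h
    rw [sub_mul, one_mul, sub_eq_zero] at this
    exact this.symm
  have hkx : k * x * e = 0 := by
    refine hint _ (k - k * y) ?_
    calc k * x * e = k * (x * e + y * k) - k * y * k := by noncomm_ring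
      _ = k - k * y * k := by rw [← h1, mul_one]
      _ = _ := by rw [sub_mul, hk]
  set q := x * e with hq
  have hqq : q * q = q := by
    rw [hq, mul_assoc, ← mul_assoc e, hee]
  have hkq : k * q = 0 := by rw [hq, ← mul_assoc, hkx]
  have hqk : (1 - q) * k = 1 - q := by
    have : 1 - q = y * k := by rw [h1]; noncomm_ring
    rw [this, mul_assoc, hk]
  have heq : e * q = e := by rw [hq, ← mul_assoc, hee]
  have hqe : q * e = q := by rw [hq, mul_assoc, he]
  obtain ⟨X, hX⟩ := hp q
  obtain ⟨Y, hY⟩ := hp e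
  -- lift `q`
  set P := (1 - K) + (1 - K) * X * K with hP
  have hKF : K * (1 - K) = 0 := by rw [mul_sub, hK, mul_one, sub_self]
  have hFK : (1 - K) * (1 - K) = 1 - K := by rw [mul_sub, sub_mul _ _ K, hK]; noncomm_ring
  have hPP : P * P = P := by
    calc P * P = (1 - K) * (1 - K) + (1 - K) * (1 - K) * X * K + (1 - K) * X * (K * (1 - K))
          + (1 - K) * X * (K * (1 - K)) * X * K := by rw [hP]; noncomm_ring
      _ = P := by rw [hKF, hFK, hP]; noncomm_ring
  have hpP : p P = q := by
    have : q * k = q - 1 + k := by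
      have : q * k = k - (1 - q) * k := by noncomm_ring
      rw [this, hqk]; noncomm_ring
    calc p P = (1 - k) + (q * k - k * q * k) := by
          rw [hP]; simp only [map_add, map_mul, map_sub, map_one, hX, ← hkdef]; noncomm_ring
      _ = q := by rw [hkq, this]; noncomm_ring
  refine ⟨P + (1 - P) * Y * P, ?_, ?_⟩
  · have hPF : P * (1 - P) = 0 := by rw [mul_sub, hPP, mul_one, sub_self]
    calc (P + (1 - P) * Y * P) * (P + (1 - P) * Y * P)
        = P * P + (P * (1 - P)) * Y * P + (1 - P) * Y * (P * P)
          + (1 - P) * Y * (P * (1 - P)) * Y * P := by noncomm_ring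
      _ = _ := by rw [hPF, hPP]; noncomm_ring
  · calc p (P + (1 - P) * Y * P) = q + (e * q - q * e * q) := by
          simp only [map_add, map_mul, map_sub, map_one, hY, hpP]; noncomm_ring
      _ = e := by rw [hqe, hqq, heq]; noncomm_ring


lemma Loc.gen (hp : Function.Surjective p)
    (hker : ∀ x, p x = 0 ↔ x ∈ Ideal.jacobson (⊥ : Ideal S)) {e : S} (he : Loc e) (y : T) (hy : y * p e ≠ 0) : ∃ w, w * (y * p e) = p e := by
  obtain ⟨x, rfl⟩ := hp y
  obtain ⟨w, hw⟩ := he.2 x (fun h => hy (by rw [← map_mul, hker]; exact h))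
  exact ⟨p w, by rw [← map_mul, ← map_mul, hw]⟩

lemma exchange (hp : Function.Surjective p)
    (hker : ∀ x, p x = 0 ↔ x ∈ Ideal.jacobson (⊥ : Ideal S)) (e : T) {f : S} (hf : Dec f) :
    ∃ g : S, g * g = g ∧ f * g = g ∧ g * f = g ∧
      (∀ x y, x * e = y * p g → x * e = 0) ∧ ∃ x y, p f = x * e + y * p g := by
  induction hf with
  | zero => exact ⟨0, by simp, by simp, by simp, by intro x y h; simpa using h, 0, 0, by simp⟩
  | add a f ha hf haf hfa ih =>
    obtain ⟨g, hgg, hfg, hgf, hint, x, y, hxy⟩ := ih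
    have hag : a * g = 0 := by rw [← hfg, ← mul_assoc, haf, zero_mul]
    have hga : g * a = 0 := by rw [← hgf, mul_assoc, hfa, mul_zero]
    by_cases hc : ∃ x y, p a = x * e + y * p g
    · obtain ⟨x', y', h'⟩ := hc
      refine ⟨g, hgg, by rw [add_mul, hag, hfg, zero_add], by rw [mul_add, hga, hgf, zero_add],
        hint, x' + x, y' + y, ?_⟩
      rw [map_add, h', hxy]; noncomm_ring
    · refine ⟨a + g, ?_, ?_, ?_, ?_, x, p a + y * p g, ?_⟩
      · simp only [mul_add, add_mul, hag, hga, hgg, ha.1, add_zero, zero_add]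
      · simp only [mul_add, add_mul, hag, hfa, hfg, ha.1, add_zero, zero_add]
      · simp only [mul_add, add_mul, haf, hga, hgf, ha.1, add_zero, zero_add]
      · intro u v huv
        have hz : v * p a = 0 := by
          by_contra hne
          obtain ⟨w, hw⟩ := ha.gen p hp hker v hne
          apply hc
          refine ⟨w * u, -(w * v), ?_⟩
          calc p a = w * (v * p (a + g)) - w * v * p g := by rw [← hw, map_add]; noncomm_ring
            _ = _ := by rw [← huv]; noncomm_ring
        refine hint u v ?_
        rw [huv, map_add, mul_add, hz, zero_add]
      · have h1 : p a * p a = p a := by rw [← map_mul, ha.1]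
        have h2 : p a * p g = 0 := by rw [← map_mul, hag, map_zero]
        have h3 : p g * p a = 0 := by rw [← map_mul, hga, map_zero]
        have h4 : p g * p g = p g := by rw [← map_mul, hgg]
        calc p (a + f) = p a + x * e + y * p g := by rw [map_add, hxy, add_assoc]
          _ = x * e + (p a * p a + p a * p g + y * (p g * p a) + y * (p g * p g)) := by
            rw [h1, h2, h3, h4]; noncomm_ring
          _ = _ := by rw [map_add]; noncomm_ring

lemma semisimple_aux (hp : Function.Surjective p)
    (hker : ∀ x, p x = 0 ↔ x ∈ Ideal.jacobson (⊥ : Ideal S)) {f : S} (hf : Dec f) : IsSemisimpleModule T (Ideal.span {p f} : Ideal T) := by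
  induction hf with
  | zero =>
    have : (Ideal.span {p 0} : Ideal T) = ⊥ := by simp
    rw [this]; exact semisimple_bot
  | add a f ha hf haf hfa ih =>
    have hs : IsSemisimpleModule T (Ideal.span {p a} : Ideal T) := by
      by_cases h0 : p a = 0
      · have : (Ideal.span {p a} : Ideal T) = ⊥ := by simp [h0]
        rw [this]; exact semisimple_bot
      · have : IsSimpleModule T (Ideal.span {p a} : Ideal T) := by
          rw [isSimpleModule_iff_isAtom]
          refine ⟨by simpa using h0, fun I hI => ?_⟩
          rw [eq_bot_iff]
          intro z hz
          by_contra hz0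
          obtain ⟨y, rfl⟩ := Ideal.mem_span_singleton'.1 (hI.le hz)
          obtain ⟨w, hw⟩ := ha.gen p hp hker y hz0
          apply hI.not_ge
          rw [Ideal.span_singleton_le_iff_mem, ← hw]
          exact Ideal.mul_mem_left I _ hz
        infer_instance
    have h2 := IsSemisimpleModule.sup hs ih
    have hle : (Ideal.span {p (a + f)} : Ideal T) ≤ Ideal.span {p a} ⊔ Ideal.span {p f} := by
      rw [Ideal.span_singleton_le_iff_mem, map_add]
      exact Submodule.add_mem_sup (Ideal.mem_span_singleton_self _) (Ideal.mem_span_singleton_self _)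
    exact IsSemisimpleModule.of_injective (Submodule.inclusion hle)
      (Submodule.inclusion_injective hle)

end lift

theorem semiperfect_of_dec {S : Type*} [Ring S] (h : Dec (1 : S)) : IsSemiperfectRing S := by
  let J : TwoSidedIdeal S := (Ideal.jacobson (⊥ : Ideal S)).toTwoSided
  have hJ : ∀ x : S, x ∈ J ↔ x ∈ Ideal.jacobson (⊥ : Ideal S) := fun x => Ideal.mem_toTwoSided
  have hp := J.ringCon.mk'_surjective
  have hker : ∀ x, J.ringCon.mk' x = 0 ↔ x ∈ Ideal.jacobson (⊥ : Ideal S) := fun x => by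
    rw [← hJ, ← TwoSidedIdeal.mem_ker, TwoSidedIdeal.ker_ringCon_mk']
  refine ⟨J, hJ, ?_, ?_⟩
  · have := semisimple_aux _ hp hker h
    rw [map_one, Ideal.span_singleton_one] at this
    exact IsSemisimpleModule.congr Submodule.topEquiv.symm
  · intro e he
    obtain ⟨g, hgg, -, -, hint, x, y, hxy⟩ := exchange _ hp hker e h
    rw [map_one] at hxy
    exact lift_exchange _ hp e he g hgg hint x y hxy

/-- Lift an idempotent orthogonally to `1 - k`. -/
lemma lift_under {S T : Type*} [Ring S] [Ring T] (p : S →+* T)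
    (hker : ∀ x, p x = 0 ↔ x ∈ Ideal.jacobson (⊥ : Ideal S))
    (hlift : ∀ e : T, e * e = e → ∃ a : S, a * a = a ∧ p a = e)
    (k : S) (hk : k * k = k) (e : T) (he : e * e = e) (h1 : p k * e = e) (h2 : e * p k = e) :
    ∃ a : S, a * a = a ∧ p a = e ∧ k * a = a ∧ a * k = a := by
  obtain ⟨a, haa, rfl⟩ := hlift e he
  have hj : -(a * (1 - k)) ∈ Ideal.jacobson (⊥ : Ideal S) := by
    rw [← hker, map_neg, map_mul, map_sub, map_one, mul_sub, h2]; simp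
  obtain ⟨z, hz1, hz2⟩ := exists_inv hj
  set u := 1 + -(a * (1 - k)) with hu
  have hpu : p u = 1 := by
    rw [hu, map_add, (hker _).2 hj]; simp
  have hpz : p z = 1 := by
    have := congrArg p hz1
    rwa [map_mul, hpu, mul_one, map_one] at this
  have huk : a * u = a * k := by
    calc a * u = a - (a * a) * (1 - k) := by rw [hu]; noncomm_ring
      _ = a * k := by rw [haa]; noncomm_ring
  have hbb : (z * a * u) * (z * a * u) = z * a * u := by
    calc (z * a * u) * (z * a * u) = z * a * (u * z) * a * u := by noncomm_ring
      _ = z * (a * a) * u := by rw [hz2]; noncomm_ring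
      _ = _ := by rw [haa]
  have hbk : (z * a * u) * k = z * a * u := by
    rw [mul_assoc z, huk, mul_assoc, mul_assoc, hk]
  set b := z * a * u with hb
  refine ⟨k * b, ?_, ?_, ?_, ?_⟩
  · rw [mul_assoc, ← mul_assoc b, hbk, hbb]
  · rw [map_mul, hb, map_mul, map_mul, hpz, hpu, one_mul, mul_one, h1]
  · rw [← mul_assoc, hk]
  · rw [mul_assoc, hbk]

lemma dec_of_lift {S T : Type*} [Ring S] [Ring T] [IsSemisimpleRing T] (p : S →+* T)
    (hp : Function.Surjective p)
    (hker : ∀ x, p x = 0 ↔ x ∈ Ideal.jacobson (⊥ : Ideal S))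
    (hlift : ∀ e : T, e * e = e → ∃ a : S, a * a = a ∧ p a = e) (I : Ideal T) :
    ∀ k : S, k * k = k → Ideal.span {p k} = I → Dec k := by
  induction I using WellFoundedLT.induction with
  | ind I ih =>
  intro k hk hI
  have hpk : p k * p k = p k := by rw [← map_mul, hk]
  by_cases hat : ∀ L : Ideal T, L < I → L = ⊥
  · refine Loc.dec ⟨hk, fun x hx => ?_⟩
    have hle : Ideal.span {p (x * k)} ≤ I := by
      rw [Ideal.span_singleton_le_iff_mem, ← hI, map_mul]
      exact Ideal.mem_span_singleton'.2 ⟨_, rfl⟩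
    have heq : Ideal.span {p (x * k)} = I := by
      by_contra hne
      have := hat _ (lt_of_le_of_ne hle hne)
      rw [Ideal.span_singleton_eq_bot, hker] at this
      exact hx this
    have hm : p k ∈ Ideal.span {p (x * k)} := by
      rw [heq, ← hI]; exact Ideal.mem_span_singleton_self _
    obtain ⟨w, hw⟩ := Ideal.mem_span_singleton'.1 hm
    obtain ⟨w, rfl⟩ := hp w
    have hj : k * w * (x * k) - k ∈ Ideal.jacobson (⊥ : Ideal S) := by
      rw [← hker, map_sub, mul_assoc, map_mul, map_mul p w, hw, hpk, sub_self]
    obtain ⟨z, hz⟩ := exists_linv hj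
    refine ⟨z * (k * w), ?_⟩
    calc z * (k * w) * (x * k) = z * (k * w * x * k - k * k + k) := by rw [hk]; noncomm_ring
      _ = z * (k * w * x * (k * k) - k * k + k) := by rw [hk]
      _ = z * (1 + (k * w * (x * k) - k)) * k := by noncomm_ring
      _ = k := by rw [hz, one_mul]
  · push Not at hat
    obtain ⟨L, hL, hL0⟩ := hat
    obtain ⟨L', hc⟩ := exists_isCompl L
    have h1 : (1 : T) ∈ L ⊔ L' := by rw [hc.sup_eq_top]; trivial
    obtain ⟨c, hcL, d, hd, hcd⟩ := Submodule.mem_sup.1 h1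
    have hLk : ∀ t ∈ L, t * p k = t := by
      intro t ht
      have := hL.le ht
      rw [← hI] at this
      obtain ⟨y, rfl⟩ := Ideal.mem_span_singleton'.1 this
      rw [mul_assoc, hpk]
    have hLc : ∀ t ∈ L, t * c = t := by
      intro t ht
      have h3 : t - t * c = t * d := by
        calc t - t * c = t * (c + d) - t * c := by rw [hcd, mul_one]
          _ = _ := by noncomm_ring
      have h4 : t * d ∈ L ⊓ L' := ⟨h3 ▸ L.sub_mem ht (Ideal.mul_mem_left _ _ hcL),
        Ideal.mul_mem_left _ _ hd⟩
      rw [hc.inf_eq_bot, Submodule.mem_bot] at h4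
      rw [h4, sub_eq_zero] at h3
      exact h3.symm
    -- the idempotent generating `L` inside the corner
    set a := p k * c with ha
    have haL : a ∈ L := Ideal.mul_mem_left _ _ hcL
    have hak : a * p k = a := hLk _ haL
    have hka : p k * a = a := by rw [ha, ← mul_assoc, hpk]
    have hLa : ∀ t ∈ L, t * a = t := by
      intro t ht
      rw [ha, ← mul_assoc, hLk t ht, hLc t ht]
    have haa : a * a = a := hLa a haL
    obtain ⟨α, hαα, hα, hkα, hαk⟩ := lift_under p hker hlift k hk a haa hka hak
    have hlt1 : Ideal.span {p α} < I := by
      refine lt_of_le_of_lt ?_ hL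
      rw [hα, Ideal.span_singleton_le_iff_mem]; exact haL
    have hlt2 : Ideal.span {p (k - α)} < I := by
      refine lt_of_le_of_ne ?_ ?_
      · rw [Ideal.span_singleton_le_iff_mem, ← hI, map_sub, hα]
        refine Submodule.sub_mem _ (Ideal.mem_span_singleton_self _) ?_
        exact Ideal.mem_span_singleton'.2 ⟨a, hak⟩
      · intro h
        apply hL0
        rw [eq_bot_iff]
        intro t ht
        have h5 := hL.le ht
        rw [← h] at h5
        obtain ⟨y, hy⟩ := Ideal.mem_span_singleton'.1 h5
        have h6 := hLa t ht
        rw [← hy, map_sub, hα, mul_assoc, sub_mul, hka, haa, sub_self, mul_zero] at h6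
        rw [map_sub, hα] at hy
        rw [Submodule.mem_bot, ← hy, ← h6]
    have d1 := ih _ hlt1 α hαα rfl
    have d2 := ih _ hlt2 (k - α) (by
      rw [sub_mul, mul_sub, mul_sub, hk, hkα, hαk, hαα]; noncomm_ring) rfl
    have := d1.sum d2 (by rw [mul_sub, hαk, hαα, sub_self]) (by rw [sub_mul, hkα, hαα, sub_self])
    simpa using this

theorem dec_of_semiperfect {S : Type*} [Ring S] (h : IsSemiperfectRing S) : Dec (1 : S) := by
  obtain ⟨J, hJ, hss, hl⟩ := h
  refine dec_of_lift J.ringCon.mk' J.ringCon.mk'_surjective (fun x => ?_) hl _ 1 (by simp) rfl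
  rw [← hJ, ← TwoSidedIdeal.mem_ker, TwoSidedIdeal.ker_ringCon_mk']

lemma corner_local {S : Type*} [Ring S] {e : S} (he : Loc e) (hi : IsIdempotentElem e)
    (a : hi.Corner) : IsUnit a ∨ IsUnit (1 - a) := by
  have hmem : ∀ b : hi.Corner, e * b.1 = b.1 ∧ b.1 * e = b.1 := fun b =>
    (Subsemigroup.mem_corner_iff hi).1 b.2
  have hlinv : ∀ b : hi.Corner, b.1 ∉ Ideal.jacobson (⊥ : Ideal S) →
      ∃ w : hi.Corner, w * b = 1 := by
    intro b hb
    obtain ⟨w, hw⟩ := he.2 b.1 (by rwa [(hmem b).2])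
    refine ⟨⟨e * w * e, w, rfl⟩, Subtype.ext ?_⟩
    change e * w * e * b.1 = e
    rw [mul_assoc, (hmem b).1, mul_assoc]
    rw [(hmem b).2] at hw
    rw [hw, he.1]
  by_cases ha : a.1 ∈ Ideal.jacobson (⊥ : Ideal S)
  · right
    obtain ⟨z, hz1, hz2⟩ := exists_inv (neg_mem ha)
    let y : hi.Corner := ⟨e * z * e, z, rfl⟩
    have h1 : y * (1 - a) = 1 := by
      refine Subtype.ext ?_
      change e * z * e * (e - a.1) = e
      calc e * z * e * (e - a.1) = e * z * (e * e - e * a.1) := by noncomm_ring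
        _ = e * z * (e - a.1 * e) := by rw [he.1, (hmem a).1, (hmem a).2]
        _ = e * (z * (1 + -a.1)) * e := by noncomm_ring
        _ = e := by rw [hz1, mul_one, he.1]
    have h2 : (1 - a) * y = 1 := by
      refine Subtype.ext ?_
      change (e - a.1) * (e * z * e) = e
      calc (e - a.1) * (e * z * e) = (e * e - a.1 * e) * z * e := by noncomm_ring
        _ = (e - e * a.1) * z * e := by rw [he.1, (hmem a).1, (hmem a).2]
        _ = e * ((1 + -a.1) * z) * e := by noncomm_ring
        _ = e := by rw [hz2, mul_one, he.1]
    exact ⟨⟨_, _, h2, h1⟩, rfl⟩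
  · left
    obtain ⟨w, hw⟩ := hlinv a ha
    by_cases hwJ : w.1 ∈ Ideal.jacobson (⊥ : Ideal S)
    · exfalso
      apply ha
      have h0 : e = 0 := by
        refine idem_mem he.1 ?_
        have : w.1 * a.1 = e := congrArg Subtype.val hw
        rw [← this]
        exact Ideal.mul_mem_right _ _ hwJ
      have h7 : a.1 = 0 := (hmem a).1.symm.trans ((congrArg (· * a.1) h0).trans (zero_mul _))
      rw [h7]
      exact Submodule.zero_mem _
    · obtain ⟨y, hy⟩ := hlinv w hwJ
      have : y = a := by
        calc y = y * (w * a) := by rw [hw, mul_one]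
          _ = a := by rw [← mul_assoc, hy, one_mul]
      subst this
      exact ⟨⟨_, _, hy, hw⟩, rfl⟩

/-- Criterion for a scaled element `X` to give a local idempotent. -/
lemma loc_main {A B : Type*} [Ring A] [Ring B] (hA : ∀ a : A, IsUnit a ∨ IsUnit (1 - a))
    (i : A →ₙ+* B) (X T : B) (n q : ℤ) (hXi : ∀ a, X * i a = i a * X)
    (hTi : ∀ a, T * i a = i a * T) (hXX : X * X = n • X) (hXT : X * T = n • T)
    (hTX : T * X = n • T) (hTT : T * T = q • T) (hq : ∀ t : A, IsUnit (1 + q • t))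
    (v : A) (hv : n • v = 1)
    (hy : ∀ y, ∃ a b, X * (i 1 * y * i 1) * X = i a * X + i b * T) : Loc (i v * X) := by
  have hvc : ∀ a, v * a = a * v := by
    intro a
    calc v * a = v * (a * (n • v)) := by rw [hv, mul_one]
      _ = (n • v) * (a * v) := by simp only [mul_smul_comm, smul_mul_assoc]
      _ = a * v := by rw [hv, one_mul]
  -- multiplication rule
  have hmul : ∀ c d a b : A, (i c * X + i d * T) * (i a * X + i b * T)
      = i (n • (c * a)) * X + i (n • (c * b) + n • (d * a) + q • (d * b)) * T := by
    intro c d a b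
    calc (i c * X + i d * T) * (i a * X + i b * T)
        = i c * (X * i a) * X + i c * (X * i b) * T + i d * (T * i a) * X
          + i d * (T * i b) * T := by noncomm_ring
      _ = i c * i a * (X * X) + i c * i b * (X * T) + i d * i a * (T * X)
          + i d * i b * (T * T) := by simp only [hXi, hTi, mul_assoc]
      _ = _ := by
          simp only [hXX, hXT, hTX, hTT, map_add, map_zsmul, map_mul, add_mul, mul_smul_comm,
            smul_mul_assoc]
          abel
  have hE : i v * X = i v * X + i 0 * T := by simp
  have hEE : i v * X * (i v * X) = i v * X := by
    rw [hE, hmul]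
    simp [← smul_mul_assoc, hv]
  -- left inverses
  have hinv : ∀ a b : A, IsUnit a → ∃ w, w * (i v * X) = w ∧ w * (i a * X + i b * T) = i v * X := by
    rintro a b ⟨u, rfl⟩
    set a' : A := ↑u⁻¹ with ha'
    have haa : a' * u = 1 := u.inv_mul
    have haa' : u * a' = 1 := u.mul_inv
    obtain ⟨m, hm⟩ := hq (v * a' * b)
    have hm1 : (↑m⁻¹ : A) * (1 + q • (v * a' * b)) = 1 := by rw [← hm]; exact m.inv_mul
    set m' : A := ↑m⁻¹
    set c : A := v * v * a' with hc
    set d : A := -(n • (c * b)) * (m' * a' * v) with hd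
    have hd1 : (m' * a' * v) * (n • (u : A) + q • b) = 1 := by
      calc (m' * a' * v) * (n • (u : A) + q • b)
          = m' * a' * (n • v) * u + q • (m' * (a' * v) * b) := by
            simp only [mul_add, mul_smul_comm, smul_mul_assoc, mul_assoc]
        _ = m' * (a' * u) + q • (m' * (v * a') * b) := by rw [hv, mul_one, hvc a', mul_assoc]
        _ = m' * (1 + q • (v * a' * b)) := by
            rw [haa]; simp only [mul_add, mul_smul_comm, mul_assoc]
        _ = 1 := hm1
    refine ⟨i c * X + i d * T, ?_, ?_⟩
    · rw [hE, hmul]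
      have h1 : ∀ t, n • (t * v) = t := fun t => by rw [← mul_smul_comm, hv, mul_one]
      simp [h1]
    · rw [hmul]
      have h1 : n • (c * u) = v := by
        rw [hc, mul_assoc, haa, mul_one, ← smul_mul_assoc, hv, one_mul]
      have h2 : n • (c * b) + n • (d * u) + q • (d * b) = 0 := by
        calc n • (c * b) + n • (d * u) + q • (d * b)
            = n • (c * b) + d * (n • (u : A) + q • b) := by
              simp only [mul_add, mul_smul_comm, add_assoc]
          _ = 0 := by rw [hd, mul_assoc (-(n • (c * b))), hd1, mul_one, add_neg_cancel]
      rw [h1, h2]; simp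
  refine ⟨hEE, fun x hx => ?_⟩
  by_contra hno
  apply hx
  rw [Ideal.mem_jacobson_iff]
  intro s
  set E := i v * X with hEdef
  obtain ⟨a, b, hab⟩ := hy (i v * (s * x) * i v)
  have hab' : E * (s * x) * E = i a * X + i b * T := by
    rw [← hab]
    have h1 : i 1 * i v = i v := by rw [← map_mul, one_mul]
    have h2 : i v * i 1 = i v := by rw [← map_mul, mul_one]
    calc E * (s * x) * E = (i v * X) * (s * x) * (i v * X) := rfl
      _ = (X * i v) * (s * x) * (i v * X) := by rw [hXi]
      _ = X * ((i 1 * i v) * (s * x) * (i v * i 1)) * X := by rw [h1, h2]; noncomm_ring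
      _ = _ := by noncomm_ring
  rcases hA (-(n • a)) with h | h
  · exfalso
    have hu : IsUnit a := by
      rw [IsUnit.neg_iff] at h
      have : a = v * (n • a) := by rw [mul_smul_comm, ← smul_mul_assoc, hv, one_mul]
      rw [this]
      refine IsUnit.mul ?_ h
      have h1 : v * n • (1 : A) = 1 := by rw [mul_smul_comm, mul_one, hv]
      have h2 : n • (1 : A) * v = 1 := by rw [smul_mul_assoc, one_mul, hv]
      exact ⟨⟨_, _, h1, h2⟩, rfl⟩
    obtain ⟨w, hw1, hw2⟩ := hinv a b hu
    rw [← hab'] at hw2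
    apply hno
    refine ⟨w * E * s, ?_⟩
    calc w * E * s * (x * E) = w * (E * (s * x) * E) := by noncomm_ring
      _ = E := hw2
  · have hu : IsUnit (v + a) := by
      have : v + a = v * (1 - -(n • a)) := by
        rw [sub_neg_eq_add, mul_add, mul_one, mul_smul_comm, ← smul_mul_assoc, hv, one_mul]
      rw [this]
      refine IsUnit.mul ?_ h
      have h1 : v * n • (1 : A) = 1 := by rw [mul_smul_comm, mul_one, hv]
      have h2 : n • (1 : A) * v = 1 := by rw [smul_mul_assoc, one_mul, hv]
      exact ⟨⟨_, _, h1, h2⟩, rfl⟩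
    obtain ⟨w, hw1, hw2⟩ := hinv (v + a) b hu
    have hw3 : w * (E * (s * x) * E) = E - w := by
      rw [hab']
      calc w * (i a * X + i b * T) = w * (i (v + a) * X + i b * T) - w * E := by
            rw [hEdef, map_add]; noncomm_ring
        _ = _ := by rw [hw2, hw1]
    refine ⟨1 - s * x * w, ?_⟩
    rw [Ideal.mem_bot]
    calc (1 - s * x * w) * s * (x * E) + (1 - s * x * w) - 1
        = s * x * E - s * x * (w * (s * x) * E) - s * x * w := by noncomm_ring
      _ = s * x * E - s * x * ((w * E) * (s * x) * E) - s * x * w := by rw [hw1]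
      _ = s * x * E - s * x * (w * (E * (s * x) * E)) - s * x * w := by noncomm_ring
      _ = 0 := by rw [hw3]; noncomm_ring

section S3
variable {A B : Type*} [Ring A] [Ring B]

/-- `loc_main` for elements of a ring spanned by words in `r, s`. -/
lemma loc_words (hA : ∀ a : A, IsUnit a ∨ IsUnit (1 - a))
    (i : A →ₙ+* B) (r s : B)
    (hspan : ∀ y, ∃ a₀ a₁ a₂ b₀ b₁ b₂ : A, i 1 * y * i 1 = i a₀ * 1 + i a₁ * r + i a₂ * (r * r)
      + i b₀ * s + i b₁ * (r * s) + i b₂ * (r * (r * s)))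
    (X T : B) (n q : ℤ) (hXi : ∀ a, X * i a = i a * X)
    (hTi : ∀ a, T * i a = i a * T) (hXX : X * X = n • X) (hXT : X * T = n • T)
    (hTX : T * X = n • T) (hTT : T * T = q • T) (hq : ∀ t : A, IsUnit (1 + q • t))
    (v : A) (hv : n • v = 1) (m₁ k₁ m₂ k₂ m₃ k₃ m₄ k₄ m₅ k₅ : ℤ)
    (h₁ : X * r * X = m₁ • X + k₁ • T) (h₂ : X * (r * r) * X = m₂ • X + k₂ • T)
    (h₃ : X * s * X = m₃ • X + k₃ • T) (h₄ : X * (r * s) * X = m₄ • X + k₄ • T)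
    (h₅ : X * (r * (r * s)) * X = m₅ • X + k₅ • T) : Loc (i v * X) := by
  refine loc_main hA i X T n q hXi hTi hXX hXT hTX hTT hq v hv fun y => ?_
  obtain ⟨a₀, a₁, a₂, b₀, b₁, b₂, h⟩ := hspan y
  refine ⟨n • a₀ + m₁ • a₁ + m₂ • a₂ + m₃ • b₀ + m₄ • b₁ + m₅ • b₂,
    k₁ • a₁ + k₂ • a₂ + k₃ • b₀ + k₄ • b₁ + k₅ • b₂, ?_⟩
  rw [h]
  have key : ∀ a g, X * (i a * g) * X = i a * (X * g * X) := fun a g => by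
    rw [← mul_assoc X, hXi]; simp only [mul_assoc]
  simp only [mul_add, add_mul, key, h₁, h₂, h₃, h₄, h₅, mul_one, map_add, map_zsmul,
    mul_smul_comm, smul_mul_assoc]
  have key1 : ∀ a, X * i a * X = n • (i a * X) := fun a => by
    rw [hXi, mul_assoc, hXX, mul_smul_comm]
  rw [key1]
  abel

end S3

section S3b
variable {A B : Type*} [Ring A] [Ring B]

lemma unit_of_nonunit (hA : ∀ a : A, IsUnit a ∨ IsUnit (1 - a)) (m k : ℤ)
    (hm : ¬ IsUnit (m : A)) (t : A) : IsUnit (1 + (m * k) • t) := by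
  rcases hA (-((m * k) • t)) with h | h
  · exfalso
    apply hm
    rw [IsUnit.neg_iff, zsmul_eq_mul, Int.cast_mul, mul_assoc] at h
    exact ((Int.cast_commute m _).isUnit_mul_iff.1 h).1
  · rwa [sub_neg_eq_add] at h

lemma exists_zinv (m : ℤ) (hm : IsUnit (m : A)) : ∃ v : A, m • v = 1 := by
  obtain ⟨u, hu⟩ := hm
  exact ⟨↑u⁻¹, by rw [zsmul_eq_mul, ← hu, u.mul_inv]⟩

lemma dec_words (hA : ∀ a : A, IsUnit a ∨ IsUnit (1 - a))
    (i : A →ₙ+* B) (r s : B) (hr : r * (r * r) = 1) (hs : s * s = 1) (hsr : s * r = r * (r * s))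
    (hri : ∀ a, r * i a = i a * r) (hsi : ∀ a, s * i a = i a * s)
    (hspan : ∀ y, ∃ a₀ a₁ a₂ b₀ b₁ b₂ : A, i 1 * y * i 1 = i a₀ * 1 + i a₁ * r + i a₂ * (r * r)
      + i b₀ * s + i b₁ * (r * s) + i b₂ * (r * (r * s))) : Dec (i 1) := by
  have hr' : ∀ x, r * (r * (r * x)) = x := fun x => by
    rw [← mul_assoc r r x, ← mul_assoc, hr, one_mul]
  have hs' : ∀ x, s * (s * x) = x := fun x => by rw [← mul_assoc, hs, one_mul]
  have hsr' : ∀ x, s * (r * x) = r * (r * (s * x)) := fun x => by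
    rw [← mul_assoc, hsr]; simp only [mul_assoc]
  have hri' : ∀ a x, r * (i a * x) = i a * (r * x) := fun a x => by
    rw [← mul_assoc, hri, mul_assoc]
  have hsi' : ∀ a x, s * (i a * x) = i a * (s * x) := fun a x => by
    rw [← mul_assoc, hsi, mul_assoc]
  obtain ⟨N, hN⟩ : ∃ N, N = 1 + r + r * r + s + r * s + r * (r * s) := ⟨_, rfl⟩
  obtain ⟨N', hN'⟩ : ∃ N, N = 1 + r + r * r - s - r * s - r * (r * s) := ⟨_, rfl⟩
  obtain ⟨H, hH⟩ : ∃ H, H = 1 - r - r * s + r * (r * s) := ⟨_, rfl⟩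
  obtain ⟨H', hH'⟩ : ∃ H, H = 1 - r * r + r * s - r * (r * s) := ⟨_, rfl⟩
  obtain ⟨C, hC⟩ : ∃ C, C = 1 + r + r * r := ⟨_, rfl⟩
  obtain ⟨P, hP⟩ : ∃ C, C = 1 + s := ⟨_, rfl⟩
  obtain ⟨M, hM⟩ : ∃ C, C = 1 - s := ⟨_, rfl⟩
  have cN : ∀ a, N * i a = i a * N := fun a => by
    simp only [hN, add_mul, sub_mul, mul_add, mul_sub, mul_assoc, hri, hsi, hri', hsi', one_mul, mul_one, zero_smul, add_zero, zero_add]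
  have cN' : ∀ a, N' * i a = i a * N' := fun a => by
    simp only [hN', add_mul, sub_mul, mul_add, mul_sub, mul_assoc, hri, hsi, hri', hsi', one_mul, mul_one, zero_smul, add_zero, zero_add]
  have cH : ∀ a, H * i a = i a * H := fun a => by
    simp only [hH, add_mul, sub_mul, mul_add, mul_sub, mul_assoc, hri, hsi, hri', hsi', one_mul, mul_one, zero_smul, add_zero, zero_add]
  have cH' : ∀ a, H' * i a = i a * H' := fun a => by
    simp only [hH', add_mul, sub_mul, mul_add, mul_sub, mul_assoc, hri, hsi, hri', hsi', one_mul, mul_one, zero_smul, add_zero, zero_add]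
  have cC : ∀ a, C * i a = i a * C := fun a => by
    simp only [hC, add_mul, sub_mul, mul_add, mul_sub, mul_assoc, hri, hsi, hri', hsi', one_mul, mul_one, zero_smul, add_zero, zero_add]
  have cP : ∀ a, P * i a = i a * P := fun a => by
    simp only [hP, add_mul, sub_mul, mul_add, mul_sub, mul_assoc, hri, hsi, hri', hsi', one_mul, mul_one, zero_smul, add_zero, zero_add]
  have cM : ∀ a, M * i a = i a * M := fun a => by
    simp only [hM, add_mul, sub_mul, mul_add, mul_sub, mul_assoc, hri, hsi, hri', hsi', one_mul, mul_one, zero_smul, add_zero, zero_add]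
  have hq0 : ∀ t : A, IsUnit (1 + (0 : ℤ) • t) := fun t => by simp
  -- orthogonality of scaled elements
  have ortho : ∀ (X Y : B) (a b : A), (∀ a, X * i a = i a * X) → X * Y = 0 →
      (i a * X) * (i b * Y) = 0 := by
    intro X Y a b h0 h
    rw [mul_assoc, ← mul_assoc X, h0, mul_assoc, h, mul_zero, mul_zero]
  -- the two blocks of the two-dimensional representation
  have LH : ∀ v : A, (3 : ℤ) • v = 1 → Loc (i v * H) := fun v hv => by
    refine loc_words hA i r s hspan H 0 3 0 cH (by simp) ?_ (by simp) (by simp) (by simp) hq0 v hv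
      0 0 (-3) 0 0 0 (-3) 0 3 0 ?_ ?_ ?_ ?_ ?_
    all_goals
      simp only [hH, add_mul, sub_mul, mul_add, mul_sub, mul_assoc, hr, hs, hsr, hr', hs', hsr',
        one_mul, mul_one, zero_smul, add_zero, zero_add]
      abel
  have LH' : ∀ v : A, (3 : ℤ) • v = 1 → Loc (i v * H') := fun v hv => by
    refine loc_words hA i r s hspan H' 0 3 0 cH' (by simp) ?_ (by simp) (by simp) (by simp) hq0 v hv
      (-3) 0 0 0 0 0 3 0 (-3) 0 ?_ ?_ ?_ ?_ ?_
    all_goals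
      simp only [hH', add_mul, sub_mul, mul_add, mul_sub, mul_assoc, hr, hs, hsr, hr', hs', hsr',
        one_mul, mul_one, zero_smul, add_zero, zero_add]
      abel
  have oHH' : H * H' = 0 := by
    simp only [hH, hH', add_mul, sub_mul, mul_add, mul_sub, mul_assoc, hr, hs, hsr, hr', hs', hsr',
      one_mul, mul_one, zero_smul, add_zero, zero_add]
    abel
  have oH'H : H' * H = 0 := by
    simp only [hH, hH', add_mul, sub_mul, mul_add, mul_sub, mul_assoc, hr, hs, hsr, hr', hs', hsr',
      one_mul, mul_one, zero_smul, add_zero, zero_add]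
    abel
  have oC : C * H = 0 ∧ C * H' = 0 ∧ H * C = 0 ∧ H' * C = 0 := by
    refine ⟨?_, ?_, ?_, ?_⟩ <;>
    · simp only [hC, hH, hH', add_mul, sub_mul, mul_add, mul_sub, mul_assoc, hr, hs, hsr, hr', hs',
        hsr', one_mul, mul_one, zero_smul, add_zero, zero_add]
      abel
  obtain ⟨oCH, oCH', oHC, oH'C⟩ := oC
  -- reduction to `C` when `3` is invertible
  have red : ∀ v : A, (3 : ℤ) • v = 1 → Dec (i v * C) → Dec (i 1) := by
    intro v hv hd
    have h1 := ((LH v hv).dec.sum (LH' v hv).dec (ortho _ _ _ _ cH oHH') (ortho _ _ _ _ cH' oH'H))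
    have h2 := hd.sum h1
      (by rw [mul_add, ortho _ _ _ _ cC oCH, ortho _ _ _ _ cC oCH', add_zero])
      (by rw [add_mul, ortho _ _ _ _ cH oHC, ortho _ _ _ _ cH' oH'C, add_zero])
    have h3 : i v * C + (i v * H + i v * H') = i 1 := by
      rw [← hv, map_zsmul, ← mul_add, ← mul_add]
      have : C + (H + H') = (3 : ℤ) • 1 := by rw [hC, hH, hH']; abel
      rw [this, mul_smul_comm, mul_one]
    rwa [h3] at h2
  by_cases u3 : IsUnit ((3 : ℤ) : A)
  · obtain ⟨v, hv⟩ := exists_zinv 3 u3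
    refine red v hv ?_
    by_cases u2 : IsUnit ((2 : ℤ) : A)
    · obtain ⟨w, hw⟩ := exists_zinv 2 u2
      have hvw : (6 : ℤ) • (v * w) = 1 := by
        have : (6 : ℤ) • (v * w) = ((3 : ℤ) • v) * ((2 : ℤ) • w) := by
          rw [smul_mul_assoc, mul_smul_comm, smul_smul]; norm_num
        rw [this, hv, hw, one_mul]
      have L1 : Loc (i (v * w) * N) := by
        refine loc_words hA i r s hspan N 0 6 0 cN (by simp) ?_ (by simp) (by simp) (by simp) hq0
          (v * w) hvw 6 0 6 0 6 0 6 0 6 0 ?_ ?_ ?_ ?_ ?_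
        all_goals
          simp only [hN, add_mul, sub_mul, mul_add, mul_sub, mul_assoc, hr, hs, hsr, hr', hs', hsr',
            one_mul, mul_one, zero_smul, add_zero, zero_add]
          abel
      have L2 : Loc (i (v * w) * N') := by
        refine loc_words hA i r s hspan N' 0 6 0 cN' (by simp) ?_ (by simp) (by simp) (by simp) hq0
          (v * w) hvw 6 0 6 0 (-6) 0 (-6) 0 (-6) 0 ?_ ?_ ?_ ?_ ?_
        all_goals
          simp only [hN', add_mul, sub_mul, mul_add, mul_sub, mul_assoc, hr, hs, hsr, hr', hs',
            hsr', one_mul, mul_one, zero_smul, add_zero, zero_add]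
          abel
      have oN : N * N' = 0 ∧ N' * N = 0 := by
        refine ⟨?_, ?_⟩ <;>
        · simp only [hN, hN', add_mul, sub_mul, mul_add, mul_sub, mul_assoc, hr, hs, hsr, hr', hs',
            hsr', one_mul, mul_one, zero_smul, add_zero, zero_add]
          abel
      have h := L1.dec.sum L2.dec (ortho _ _ _ _ cN oN.1) (ortho _ _ _ _ cN' oN.2)
      have h3 : i (v * w) * N + i (v * w) * N' = i v * C := by
        have : N + N' = (2 : ℤ) • C := by rw [hC, hN, hN']; abel
        rw [← mul_add, this, mul_smul_comm, ← smul_mul_assoc, ← map_zsmul, ← mul_smul_comm, hw,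
          mul_one]
      rwa [h3] at h
    · refine Loc.dec (loc_words hA i r s hspan C N' 3 6 cC cN' ?_ ?_ ?_ ?_
        (unit_of_nonunit hA 2 3 u2) v hv 3 0 3 0 3 (-3) 3 (-3) 3 (-3) ?_ ?_ ?_ ?_ ?_)
      all_goals
        simp only [hC, hN', add_mul, sub_mul, mul_add, mul_sub, mul_assoc, hr, hs, hsr, hr', hs',
          hsr', one_mul, mul_one, zero_smul, add_zero, zero_add]
        abel
  · have u2 : IsUnit ((2 : ℤ) : A) := by
      rcases hA ((3 : ℤ) : A) with h | h
      · exact absurd h u3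
      · rw [← IsUnit.neg_iff] at h
        convert h using 1
        push_cast
        norm_num
    obtain ⟨w, hw⟩ := exists_zinv 2 u2
    have L1 : Loc (i w * P) := by
      refine loc_words hA i r s hspan P N 2 6 cP cN ?_ ?_ ?_ ?_
        (unit_of_nonunit hA 3 2 u3) w hw (-1) 1 (-1) 1 2 0 (-1) 1 (-1) 1 ?_ ?_ ?_ ?_ ?_
      all_goals
        simp only [hP, hN, add_mul, sub_mul, mul_add, mul_sub, mul_assoc, hr, hs, hsr, hr', hs',
          hsr', one_mul, mul_one, zero_smul, add_zero, zero_add]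
        abel
    have L2 : Loc (i w * M) := by
      refine loc_words hA i r s hspan M N' 2 6 cM cN' ?_ ?_ ?_ ?_
        (unit_of_nonunit hA 3 2 u3) w hw (-1) 1 (-1) 1 (-2) 0 1 (-1) 1 (-1) ?_ ?_ ?_ ?_ ?_
      all_goals
        simp only [hM, hN', add_mul, sub_mul, mul_add, mul_sub, mul_assoc, hr, hs, hsr, hr', hs',
          hsr', one_mul, mul_one, zero_smul, add_zero, zero_add]
        abel
    have oP : P * M = 0 ∧ M * P = 0 := by
      refine ⟨?_, ?_⟩ <;>
      · simp only [hP, hM, add_mul, sub_mul, mul_add, mul_sub, hs, one_mul, mul_one, zero_smul, add_zero, zero_add]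
        abel
    have h := L1.dec.sum L2.dec (ortho _ _ _ _ cP oP.1) (ortho _ _ _ _ cM oP.2)
    have h3 : i w * P + i w * M = i 1 := by
      have : P + M = (2 : ℤ) • 1 := by rw [hP, hM]; abel
      rw [← mul_add, this, mul_smul_comm, mul_one, ← map_zsmul, hw]
    rwa [h3] at h

end S3b

open MonoidAlgebra in
lemma dec_single {R : Type*} [Ring R] {e : R} (he : Loc e) :
    Dec (single 1 e : MonoidAlgebra R (Equiv.Perm (Fin 3))) := by
  have hi : IsIdempotentElem e := he.1
  let i : hi.Corner →ₙ+* MonoidAlgebra R (Equiv.Perm (Fin 3)) :=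
    { toFun := fun a => single 1 a.1
      map_mul' := fun a b => by
        rw [single_mul_single, mul_one]; rfl
      map_zero' := single_zero _
      map_add' := fun a b => single_add _ _ _ }
  have hi' : ∀ a, i a = single 1 a.1 := fun _ => rfl
  have main := dec_words (corner_local he hi) i (single (finRotate 3) 1)
    (single (Equiv.swap 0 1) 1) ?_ ?_ ?_ ?_ ?_ ?_
  · exact main
  · rw [single_mul_single, single_mul_single, one_def]; congr 1; · decide
    · simp
  · rw [single_mul_single, one_def]; congr 1; · decide
    · simp
  · rw [single_mul_single, single_mul_single, single_mul_single]; congr 1; · decide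
    · simp
  · intro a; rw [hi', single_mul_single, single_mul_single]; simp
  · intro a; rw [hi', single_mul_single, single_mul_single]; simp
  · intro y
    induction y using MonoidAlgebra.induction_linear with
    | zero => exact ⟨0, 0, 0, 0, 0, 0, by simp⟩
    | add f g hf hg =>
      obtain ⟨a₀, a₁, a₂, b₀, b₁, b₂, h⟩ := hf
      obtain ⟨c₀, c₁, c₂, d₀, d₁, d₂, h'⟩ := hg
      refine ⟨a₀ + c₀, a₁ + c₁, a₂ + c₂, b₀ + d₀, b₁ + d₁, b₂ + d₂, ?_⟩
      rw [mul_add, add_mul, h, h']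
      simp only [map_add, add_mul]
      abel
    | single g a =>
      let c : hi.Corner := ⟨e * a * e, a, rfl⟩
      have hc : c.1 = e * a * e := rfl
      have h1 : (1 : hi.Corner).1 = e := rfl
      have hg : g = 1 ∨ g = finRotate 3 ∨ g = finRotate 3 * finRotate 3 ∨ g = Equiv.swap 0 1 ∨
          g = finRotate 3 * Equiv.swap 0 1 ∨ g = finRotate 3 * (finRotate 3 * Equiv.swap 0 1) := by
        revert g; decide
      have hl : i 1 * single g a * i 1 = i c * single g 1 := by
        rw [hi', hi', hc, h1, single_mul_single, single_mul_single, single_mul_single]; simp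
      rw [hl]
      rcases hg with h | h | h | h | h | h
      · exact ⟨c, 0, 0, 0, 0, 0, by rw [h, one_def]; simp⟩
      · exact ⟨0, c, 0, 0, 0, 0, by rw [h]; simp⟩
      · exact ⟨0, 0, c, 0, 0, 0, by rw [h, single_mul_single]; simp⟩
      · exact ⟨0, 0, 0, c, 0, 0, by rw [h]; simp⟩
      · exact ⟨0, 0, 0, 0, c, 0, by rw [h, single_mul_single]; simp⟩
      · exact ⟨0, 0, 0, 0, 0, c, by rw [h, single_mul_single, single_mul_single]; simp⟩

open MonoidAlgebra in
lemma dec_group {R : Type*} [Ring R] {f : R} (hf : Dec f) :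
    Dec (single 1 f : MonoidAlgebra R (Equiv.Perm (Fin 3))) := by
  induction hf with
  | zero => rw [single_zero]; exact Dec.zero
  | add a f ha hf haf hfa ih =>
    rw [single_add]
    refine (dec_single ha).sum ih ?_ ?_
    · rw [single_mul_single, haf, single_zero]
    · rw [single_mul_single, hfa, single_zero]

end SPS

/-- If `R` is a semiperfect ring, then the group ring `R[S₃]` of the symmetric group on
three letters over `R` is semiperfect. -/
theorem monoidAlgebra_symmGroupThree_isSemiperfect {R : Type*} [Ring R]
    (hR : IsSemiperfectRing R) :
    IsSemiperfectRing (MonoidAlgebra R (Equiv.Perm (Fin 3))) := by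
  exact SPS.semiperfect_of_dec (SPS.dec_group (SPS.dec_of_semiperfect hR))
end

section
/- Let R be an Abelian exchange ring and G a locally finite group. Then the following conditions are equivalent: (i) the identity of the group ring RG is a sum of two units of RG; (ii) the identity of R is a sum of two units of R; (iii) R has no factor ring isomorphic to ℤ/2ℤ (there is no surjective ring homomorphism from R onto the field with two elements); (iv) every element of RG is a sum of two units of RG. -/
/-- `x` is a sum of two units. -/
def IsTwoGood {A : Type*} [Ring A] (x : A) : Prop := ∃ u v : A, IsUnit u ∧ IsUnit v ∧ x = u + v

theorem IsTwoGood.map {A B : Type*} [Ring A] [Ring B] (f : A →+* B) {x : A} (h : IsTwoGood x) :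
    IsTwoGood (f x) := by
  obtain ⟨u, v, hu, hv, rfl⟩ := h
  exact ⟨f u, f v, hu.map f, hv.map f, map_add _ _ _⟩

theorem isLocalHom_of_left_inv {A B : Type*} [Ring A] [Ring B] (f : A →+* B)
    (hs : Function.Surjective f) (h : ∀ a, f a = 1 → ∃ b, b * a = 1) (a : A) (ha : IsUnit (f a)) :
    IsUnit a := by
  have key : ∀ a, f a = 1 → IsUnit a := by
    intro a ha
    obtain ⟨b, hb⟩ := h a ha
    have hfb : f b = 1 := by
      have := congrArg f hb
      simpa [ha] using this
    obtain ⟨c, hc⟩ := h b hfb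
    have : c = a := by
      calc c = c * (b * a) := by rw [hb, mul_one]
        _ = a := by rw [← mul_assoc, hc, one_mul]
    subst this
    exact ⟨⟨c, b, hc, hb⟩, rfl⟩
  obtain ⟨w, hw⟩ := ha
  obtain ⟨b, hb⟩ := hs (↑w⁻¹ : B)
  have h1 : IsUnit (a * b) := key _ (by rw [map_mul, hb, ← hw, Units.mul_inv])
  have h2 : IsUnit (b * a) := key _ (by rw [map_mul, hb, ← hw, Units.inv_mul])
  obtain ⟨c, hc⟩ := h1.exists_right_inv
  obtain ⟨d, hd⟩ := h2.exists_left_inv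
  rw [isUnit_iff_exists_and_exists]
  exact ⟨⟨b * c, by rw [← mul_assoc, hc]⟩, ⟨d * b, by rw [mul_assoc, hd]⟩⟩

theorem IsTwoGood.of_map {A B : Type*} [Ring A] [Ring B] (f : A →+* B)
    (hs : Function.Surjective f) (h : ∀ a, f a = 1 → ∃ b, b * a = 1) {x : A}
    (hx : IsTwoGood (f x)) : IsTwoGood x := by
  obtain ⟨u, v, hu, hv, e⟩ := hx
  obtain ⟨u, rfl⟩ := hs u
  refine ⟨u, x - u, isLocalHom_of_left_inv f hs h _ hu, isLocalHom_of_left_inv f hs h _ ?_, by simp⟩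
  rw [map_sub, e]; simpa using hv

theorem left_inv_of_mk_jacobson {A : Type*} [Ring A] (a : A)
    (h : Ideal.Quotient.mk (Ring.jacobson A) a = 1) : ∃ b, b * a = 1 := by
  have h1 : 1 - a ∈ Ring.jacobson A := by
    rw [← Ideal.Quotient.eq_zero_iff_mem, map_sub, h, map_one, sub_self]
  by_contra hc
  have : Ideal.span {a} ≠ ⊤ := by
    intro ht
    rw [Ideal.eq_top_iff_one, Ideal.mem_span_singleton'] at ht
    exact hc ht
  obtain ⟨m, hm, hle⟩ := Ideal.exists_le_maximal _ this
  have ha : a ∈ m := hle (Ideal.mem_span_singleton_self a)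
  have := m.add_mem (Ring.jacobson_le_of_isMaximal m h1) ha
  rw [sub_add_cancel] at this
  exact hm.ne_top ((Ideal.eq_top_iff_one _).2 this)

instance finite_monoidAlgebra' {S G : Type*} [Ring S] [Group G] [Finite G] :
    Module.Finite S (MonoidAlgebra S G) :=
  Module.Finite.equiv (MonoidAlgebra.coeffLinearEquiv S : MonoidAlgebra S G ≃ₗ[S] (G →₀ S)).symm

theorem left_inv_of_map_jacobson {S G : Type*} [Ring S] [Group G] [Finite G] (a : MonoidAlgebra S G)
    (h : MonoidAlgebra.mapRingHom G (Ideal.Quotient.mk (Ring.jacobson S)) a = 1) :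
    ∃ b, b * a = 1 := by
  by_contra hc
  let L : Submodule S (MonoidAlgebra S G) := (Ideal.span {a}).restrictScalars S
  have hL : L ≠ ⊤ := by
    intro ht
    have : (1 : MonoidAlgebra S G) ∈ L := by rw [ht]; trivial
    simp only [L, Submodule.restrictScalars_mem] at this
    rw [Ideal.mem_span_singleton'] at this
    exact hc this
  obtain ⟨m, hm, hle⟩ := (eq_top_or_exists_le_coatom L).resolve_left hL
  apply hm.1
  rw [eq_top_iff]
  intro b _
  have h1 : b * a ∈ m := hle (by
    simp only [L, Submodule.restrictScalars_mem]
    rw [Ideal.mem_span_singleton']; exact ⟨b, rfl⟩)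
  have h2 : b - b * a ∈ m := by
    have hk : MonoidAlgebra.mapRingHom G (Ideal.Quotient.mk (Ring.jacobson S)) (b - b * a) = 0 := by
      rw [map_sub, map_mul, h, mul_one, sub_self]
    generalize b - b * a = c at hk
    rw [← MonoidAlgebra.sum_coeff_single c]
    refine Submodule.sum_mem _ fun g _ => ?_
    have hg : c.coeff g ∈ Ring.jacobson S := by
      rw [← Ideal.Quotient.eq_zero_iff_mem, ← MonoidAlgebra.coeff_mapRingHom, hk]; rfl
    have h3 : MonoidAlgebra.single g (c.coeff g) ∈
        Ring.jacobson S • (⊤ : Submodule S (MonoidAlgebra S G)) := by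
      have := Submodule.smul_mem_smul (N := (⊤ : Submodule S (MonoidAlgebra S G))) hg
        (n := MonoidAlgebra.single g 1) trivial
      simpa using this
    have h4 := Ring.jacobson_smul_top_le S _ h3
    exact (sInf_le (show m ∈ {m : Submodule S (MonoidAlgebra S G) | IsCoatom m} from hm)) h4
  have := m.add_mem h2 h1
  simpa using this

theorem mapRingHom_surj {S T G : Type*} [Ring S] [Ring T] [Group G] (f : S →+* T)
    (hf : Function.Surjective f) : Function.Surjective (MonoidAlgebra.mapRingHom G f) := by
  intro y
  induction y using MonoidAlgebra.induction_linear with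
  | zero => exact ⟨0, map_zero _⟩
  | add a b ha hb =>
    obtain ⟨a, rfl⟩ := ha
    obtain ⟨b, rfl⟩ := hb
    exact ⟨a + b, map_add _ _ _⟩
  | single g r =>
    obtain ⟨r, rfl⟩ := hf r
    exact ⟨MonoidAlgebra.single g r, by simp⟩

/-! ### matrices -/

theorem isUnit_fromBlocks_upper {S m n : Type*} [Ring S] [Fintype m] [Fintype n] [DecidableEq m]
    [DecidableEq n] {A : Matrix m m S} {D : Matrix n n S} (B : Matrix m n S)
    (hA : IsUnit A) (hD : IsUnit D) : IsUnit (Matrix.fromBlocks A B 0 D) := by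
  obtain ⟨a, rfl⟩ := hA
  obtain ⟨d, rfl⟩ := hD
  refine ⟨⟨Matrix.fromBlocks (a : Matrix m m S) B 0 (d : Matrix n n S),
    Matrix.fromBlocks (↑a⁻¹ : Matrix m m S) (-((↑a⁻¹ : Matrix m m S) * B *
    (↑d⁻¹ : Matrix n n S))) 0 (↑d⁻¹ : Matrix n n S), ?_, ?_⟩, rfl⟩
  · simp [Matrix.fromBlocks_multiply, ← Matrix.mul_assoc, Matrix.fromBlocks_one]
  · simp [Matrix.fromBlocks_multiply, Matrix.mul_assoc, Matrix.fromBlocks_one]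

theorem isUnit_fromBlocks_lower {S m n : Type*} [Ring S] [Fintype m] [Fintype n] [DecidableEq m]
    [DecidableEq n] {A : Matrix m m S} {D : Matrix n n S} (C : Matrix n m S)
    (hA : IsUnit A) (hD : IsUnit D) : IsUnit (Matrix.fromBlocks A 0 C D) := by
  obtain ⟨a, rfl⟩ := hA
  obtain ⟨d, rfl⟩ := hD
  refine ⟨⟨Matrix.fromBlocks (a : Matrix m m S) 0 C (d : Matrix n n S),
    Matrix.fromBlocks (↑a⁻¹ : Matrix m m S) 0 (-((↑d⁻¹ : Matrix n n S) * C *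
    (↑a⁻¹ : Matrix m m S)))  (↑d⁻¹ : Matrix n n S), ?_, ?_⟩, rfl⟩
  · simp [Matrix.fromBlocks_multiply, ← Matrix.mul_assoc, Matrix.fromBlocks_one]
  · simp [Matrix.fromBlocks_multiply, Matrix.mul_assoc, Matrix.fromBlocks_one]

theorem isTwoGood_matrix {S : Type*} [Ring S] (h : ∀ x : S, IsTwoGood x) (n : ℕ) :
    ∀ x : Matrix (Fin n) (Fin n) S, IsTwoGood x := by
  induction n with
  | zero => exact fun x => ⟨1, 1, isUnit_one, isUnit_one, Subsingleton.elim _ _⟩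
  | succ n ih =>
    have h1 : ∀ x : Matrix (Fin 1) (Fin 1) S, IsTwoGood x := by
      intro x
      have := (h (Matrix.uniqueRingEquiv x)).map
        (Matrix.uniqueRingEquiv (m := Fin 1) (A := S)).symm.toRingHom
      have e : (Matrix.uniqueRingEquiv (m := Fin 1) (A := S)).symm.toRingHom
        (Matrix.uniqueRingEquiv x) = x := RingEquiv.symm_apply_apply _ x
      rwa [e] at this
    have h2 : ∀ x : Matrix (Fin n ⊕ Fin 1) (Fin n ⊕ Fin 1) S, IsTwoGood x := by
      intro x
      obtain ⟨u, v, hu, hv, e⟩ := ih x.toBlocks₁₁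
      obtain ⟨u', v', hu', hv', e'⟩ := h1 x.toBlocks₂₂
      refine ⟨_, _, isUnit_fromBlocks_upper x.toBlocks₁₂ hu hu',
        isUnit_fromBlocks_lower x.toBlocks₂₁ hv hv', ?_⟩
      rw [Matrix.fromBlocks_add, ← e, ← e']
      simp [Matrix.fromBlocks_toBlocks]
    intro x
    have := (h2 ((Matrix.reindexRingEquiv S (finSumFinEquiv (m := n) (n := 1))).symm x)).map
        (Matrix.reindexRingEquiv S (finSumFinEquiv (m := n) (n := 1))).toRingHom
    simpa using this

theorem isTwoGood_divisionRing {D : Type*} [DivisionRing D] (hD : Nat.card D ≠ 2) (x : D) :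
    IsTwoGood x := by
  by_cases hx : x = 0
  · exact ⟨1, -1, isUnit_one, isUnit_one.neg, by simp [hx]⟩
  · have : ∃ u : D, u ≠ 0 ∧ u ≠ x := by
      by_contra! hc
      apply hD
      rw [Nat.card_eq_two_iff]
      refine ⟨0, x, Ne.symm hx, ?_⟩
      ext u
      simp only [Set.mem_insert_iff, Set.mem_singleton_iff, Set.mem_univ, iff_true]
      by_cases hu : u = 0
      · exact .inl hu
      · exact .inr (hc u hu)
    obtain ⟨u, h0, h1⟩ := this
    exact ⟨u, x - u, h0.isUnit, (sub_ne_zero.2 h1.symm).isUnit, by simp⟩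

theorem card_ne_two_of_surj {D G D' : Type*} [DivisionRing D] [Group G] [DivisionRing D']
    (hD : Nat.card D ≠ 2) (n : ℕ) [NeZero n]
    (g : MonoidAlgebra D G →+* Matrix (Fin n) (Fin n) D') (hg : Function.Surjective g) :
    Nat.card D' ≠ 2 := by
  intro h
  have hfin : Finite D' := Nat.finite_of_card_ne_zero (by omega)
  let φ : D →+* Matrix (Fin n) (Fin n) D' := g.comp MonoidAlgebra.singleOneRingHom
  have hφ : Function.Injective φ := φ.injective
  have : Finite D := Finite.of_injective φ hφ
  have hcomm : ∀ x y : D, x * y = y * x := (littleWedderburn D).mul_comm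
  have hsc : ∀ d, ∃ c, Matrix.scalar (Fin n) c = φ d := by
    intro d
    refine Matrix.mem_range_scalar_iff_commute_single'.2 fun i j => ?_
    obtain ⟨y, hy⟩ := hg (Matrix.single i j 1)
    rw [← hy]
    refine Commute.map (Commute.symm ?_) g
    exact MonoidAlgebra.single_commute (fun _ => Commute.one_left _) (fun r => hcomm _ _) y
  choose c hc using hsc
  have hinj : Function.Injective c := fun a b hab => hφ (by rw [← hc, ← hc, hab])
  have h1 := Nat.card_le_card_of_injective c hinj
  have h2 := (Finite.one_lt_card_iff_nontrivial (α := D)).2 inferInstance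
  omega

theorem isTwoGood_divisionRing_monoidAlgebra {D G : Type*} [DivisionRing D] [Group G] [Finite G]
    (hD : Nat.card D ≠ 2) (x : MonoidAlgebra D G) : IsTwoGood x := by
  have : IsArtinianRing (MonoidAlgebra D G) := IsArtinianRing.of_finite D _
  refine IsTwoGood.of_map (Ideal.Quotient.mk (Ring.jacobson (MonoidAlgebra D G)))
    Ideal.Quotient.mk_surjective left_inv_of_mk_jacobson ?_
  obtain ⟨n, D', d, _, hd, ⟨e⟩⟩ := IsSemisimpleRing.exists_ringEquiv_pi_matrix_divisionRing
    (MonoidAlgebra D G ⧸ Ring.jacobson (MonoidAlgebra D G))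
  have hall : ∀ y : Π i, Matrix (Fin (d i)) (Fin (d i)) (D' i), IsTwoGood y := by
    intro y
    have : ∀ i, IsTwoGood (y i) := by
      intro i
      refine isTwoGood_matrix (isTwoGood_divisionRing ?_) _ _
      refine card_ne_two_of_surj hD (d i) (((Pi.evalRingHom _ i).comp e.toRingHom).comp
        (Ideal.Quotient.mk (Ring.jacobson (MonoidAlgebra D G)))) ?_
      exact ((Function.surjective_eval i).comp e.surjective).comp Ideal.Quotient.mk_surjective
    choose u v hu hv huv using this
    exact ⟨u, v, Pi.isUnit_iff.2 hu, Pi.isUnit_iff.2 hv, funext huv⟩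
  have := (hall (e (Ideal.Quotient.mk _ x))).map e.symm.toRingHom
  simpa using this

theorem isTwoGood_local {S G : Type*} [Ring S] [Nontrivial S] [Group G] [Finite G]
    (h : ∀ a : S, (∃ r, a * r = 1) ∨ (∃ r, (1 - a) * r = 1))
    (h3 : ¬ ∃ f : S →+* ZMod 2, Function.Surjective f) (x : MonoidAlgebra S G) : IsTwoGood x := by
  have hid : ∀ f : S, f * f = f → (∃ r, f * r = 1) → f = 1 := by
    rintro f hf ⟨r, hr⟩
    calc f = f * (f * r) := by rw [hr, mul_one]
      _ = 1 := by rw [← mul_assoc, hf, hr]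
  have hded : ∀ a b : S, a * b = 1 → b * a = 1 := by
    intro a b hab
    have hf : (b * a) * (b * a) = b * a := by
      rw [mul_assoc, ← mul_assoc a, hab, one_mul]
    rcases h (b * a) with h1 | h1
    · exact hid _ hf h1
    · have h2 := hid (1 - b * a) (by
        rw [sub_mul, mul_sub, mul_sub, hf]; simp) h1
      have h0 : b * a = 0 := by simpa using h2
      exfalso
      have : (1 : S) = a * (b * a) * b := by
        rw [← mul_assoc, hab, one_mul, hab]
      rw [h0] at this
      simp at this
  have hu : ∀ a : S, (∃ r, a * r = 1) → IsUnit a := by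
    rintro a ⟨r, hr⟩
    exact ⟨⟨a, r, hr, hded _ _ hr⟩, rfl⟩
  have hJ : ∀ a : S, IsUnit a ∨ a ∈ Ring.jacobson S := by
    intro a
    by_cases ha : IsUnit a
    · exact .inl ha
    right
    rw [Ring.jacobson_eq_sInf_isMaximal, Submodule.mem_sInf]
    intro m hm
    have hm : Ideal.IsMaximal m := hm
    by_contra ham
    obtain ⟨t, y, hy, hty⟩ := hm.exists_inv ham
    rcases h (t * a) with h1 | h1
    · obtain ⟨w, hw⟩ := (hu _ h1).exists_left_inv
      rw [← mul_assoc] at hw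
      exact ha ⟨⟨a, w * t, hded _ _ hw, hw⟩, rfl⟩
    · have : 1 - t * a = y := by rw [← hty]; simp
      rw [this] at h1
      exact hm.ne_top (Ideal.eq_top_of_isUnit_mem _ hy (hu _ h1))
  have hD : ∀ d : S ⧸ Ring.jacobson S, IsUnit d ∨ d = 0 := by
    intro d
    obtain ⟨a, rfl⟩ := Ideal.Quotient.mk_surjective d
    rcases hJ a with h1 | h1
    · exact .inl (h1.map _)
    · exact .inr (Ideal.Quotient.eq_zero_iff_mem.2 h1)
  have hnt : Nontrivial (S ⧸ Ring.jacobson S) :=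
    Ideal.Quotient.nontrivial_iff.2 (Ring.jacobson_lt_top S).ne
  refine IsTwoGood.of_map (MonoidAlgebra.mapRingHom G (Ideal.Quotient.mk (Ring.jacobson S)))
    (mapRingHom_surj _ Ideal.Quotient.mk_surjective) left_inv_of_map_jacobson ?_
  have hcard : Nat.card (S ⧸ Ring.jacobson S) ≠ 2 := by
    intro hc
    have : Finite (S ⧸ Ring.jacobson S) := Nat.finite_of_card_ne_zero (by omega)
    have := Fintype.ofFinite (S ⧸ Ring.jacobson S)
    have e := ZMod.ringEquivOfPrime (S ⧸ Ring.jacobson S) Nat.prime_two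
      (by rw [← hc, Nat.card_eq_fintype_card])
    exact h3 ⟨e.symm.toRingHom.comp (Ideal.Quotient.mk _),
      e.symm.surjective.comp Ideal.Quotient.mk_surjective⟩
  let _ := DivisionRing.ofIsUnitOrEqZero hD
  exact isTwoGood_divisionRing_monoidAlgebra hcard _

/-- `x` is a sum of two units on the part cut out by `E`. -/
def GoodOn {A : Type*} [Ring A] (x E : A) : Prop :=
  ∃ u u' v v' : A, E * x = E * (u + v) ∧ E * (u * u') = E ∧ E * (u' * u) = E ∧
    E * (v * v') = E ∧ E * (v' * v) = E

theorem congr_mul_central {A : Type*} [Ring A] {E : A} (hE : ∀ a, E * a = a * E) {a b c d : A}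
    (h1 : E * a = E * b) (h2 : E * c = E * d) : E * (a * c) = E * (b * d) := by
  rw [← mul_assoc, h1, mul_assoc, ← mul_assoc E b, hE b, mul_assoc, h2, ← mul_assoc b, ← hE b,
    mul_assoc]

theorem GoodOn.join {A : Type*} [Ring A] {x E F : A} (hE : ∀ a, E * a = a * E)
    (hEE : E * E = E) (h1 : GoodOn x E) (h2 : GoodOn x F) :
    GoodOn x (E + F - E * F) := by
  obtain ⟨u, u', v, v', ex, e1, e2, e3, e4⟩ := h1
  obtain ⟨p, p', q, q', fx, f1, f2, f3, f4⟩ := h2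
  have hN : ∀ a, (1 - E) * a = a * (1 - E) := fun a => by rw [sub_mul, mul_sub, hE]; simp
  have s1 : ∀ a b, E * (E * a + (1 - E) * b) = E * a := by
    intro a b
    rw [mul_add, ← mul_assoc, ← mul_assoc, mul_sub, hEE]; simp
  have s2 : ∀ a b, (1 - E) * (E * a + (1 - E) * b) = (1 - E) * b := by
    intro a b
    have h0 : (1 - E) * E = 0 := by rw [sub_mul, hEE, one_mul, sub_self]
    rw [mul_add, ← mul_assoc, ← mul_assoc, mul_sub, h0]; simp
  have hH : E + F - E * F = E + F * (1 - E) := by rw [mul_sub, ← hE F]; simp; abel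
  have key : ∀ y z s t, E * y = E * s → (1 - E) * y = (1 - E) * t →
      E * s = E * z → F * t = F * z → (E + F - E * F) * y = (E + F - E * F) * z := by
    intro y z s t h1 h2 h3 h4
    rw [hH, add_mul, add_mul, h1, h3, mul_assoc, h2, ← mul_assoc, ← hN, mul_assoc, h4, ← mul_assoc,
      hN]
  have fin1 : ∀ a a' b b', E * (a * a') = E → F * (b * b') = F →
      (E + F - E * F) * ((E * a + (1 - E) * b) * (E * a' + (1 - E) * b')) = E + F - E * F := by
    intro a a' b b' h1 h2
    rw [key _ 1 (a * a') (b * b') (congr_mul_central hE (s1 _ _) (s1 _ _))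
      (congr_mul_central hN (s2 _ _) (s2 _ _)) (by rw [h1, mul_one]) (by rw [h2, mul_one]), mul_one]
  refine ⟨E * u + (1 - E) * p, E * u' + (1 - E) * p', E * v + (1 - E) * q, E * v' + (1 - E) * q',
    ?_, fin1 _ _ _ _ e1 f1, fin1 _ _ _ _ e2 f2, fin1 _ _ _ _ e3 f3, fin1 _ _ _ _ e4 f4⟩
  refine (key _ _ (u + v) (p + q) ?_ ?_ ex.symm fx.symm).symm
  · rw [mul_add, s1, s1, mul_add]
  · rw [mul_add, s2, s2, mul_add]

theorem idem_join {R : Type*} [Ring R] {e f : R} (he : IsIdempotentElem e)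
    (hf : IsIdempotentElem f) (hc : ∀ r, e * r = r * e) : IsIdempotentElem (e + f - e * f) := by
  have he : e * e = e := he
  have hf : f * f = f := hf
  have h1 : f * e = e * f := (hc f).symm
  have h2 : e * (e * f) = e * f := by rw [← mul_assoc, he]
  have h3 : f * (e * f) = e * f := by rw [← mul_assoc, h1, mul_assoc, hf]
  have h4 : e * f * e = e * f := by rw [← hc, h2]
  have h5 : e * f * f = e * f := by rw [mul_assoc, hf]
  have h6 : e * f * (e * f) = e * f := by rw [← mul_assoc, h4, h5]
  show (e + f - e * f) * (e + f - e * f) = _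
  simp only [mul_sub, sub_mul, mul_add, add_mul, he, hf, h1, h2, h3, h4, h5, h6]
  abel

theorem join_absorb_left {A : Type*} [Ring A] {e f a : A} (hc : ∀ r, e * r = r * e)
    (h : e * a = a) : (e + f - e * f) * a = a := by
  rw [sub_mul, add_mul, hc f, mul_assoc, h]; simp

theorem join_absorb_right {A : Type*} [Ring A] {e f a : A}
    (h : f * a = a) : (e + f - e * f) * a = a := by
  rw [sub_mul, add_mul, mul_assoc, h]; simp

theorem exists_prime_idem {R A : Type*} [Ring R] [Ring A] (φ : R →+* A)
    (hφ : ∀ e, IsIdempotentElem e → ∀ a, φ e * a = a * φ e) (x : A) (hx : ¬ IsTwoGood x)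
    (habelian : ∀ e : R, IsIdempotentElem e → ∀ r : R, e * r = r * e) :
    ∃ M : R → Prop, (∀ e, M e → IsIdempotentElem e) ∧
      (∀ e f, M e → M f → M (e + f - e * f)) ∧ (∀ e, IsIdempotentElem e → M e ∨ M (1 - e)) ∧
      (∀ e, M e → M (1 - e) → False) ∧ (∀ e, IsIdempotentElem e → GoodOn x (φ e) → M e) := by
  have hcen : ∀ e, IsIdempotentElem e → e ∈ Subring.center R := fun e he =>
    Subring.mem_center_iff.2 fun g => (habelian e he g).symm
  let I0 : Ideal (Subring.center R) :=
    { carrier := {z | ∃ e : R, IsIdempotentElem e ∧ GoodOn x (φ e) ∧ e * (z : R) = z}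
      zero_mem' := ⟨0, IsIdempotentElem.zero, ⟨0, 0, 0, 0, by simp⟩, by simp⟩
      add_mem' := by
        rintro z w ⟨e, he, hg, hz⟩ ⟨f, hf, hg', hw⟩
        refine ⟨e + f - e * f, idem_join he hf (habelian e he), ?_, ?_⟩
        · have := hg.join (hφ e he) (by rw [← map_mul, he.eq]) hg'
          simpa using this
        · rw [Subring.coe_add, mul_add, join_absorb_left (habelian e he) hz, join_absorb_right hw]
      smul_mem' := by
        rintro c z ⟨e, he, hg, hz⟩
        refine ⟨e, he, hg, ?_⟩
        rw [smul_eq_mul, Subring.coe_mul, ← mul_assoc, habelian e he, mul_assoc, hz] }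
  have hI0 : I0 ≠ ⊤ := by
    rw [Ne, Ideal.eq_top_iff_one]
    rintro ⟨e, he, ⟨u, u', v, v', ex, e1, e2, e3, e4⟩, h1⟩
    have : e = 1 := by simpa using h1
    subst this
    simp only [map_one, one_mul] at *
    exact hx ⟨u, v, ⟨⟨u, u', e1, e2⟩, rfl⟩, ⟨⟨v, v', e3, e4⟩, rfl⟩, ex⟩
  obtain ⟨m, hm, hle⟩ := Ideal.exists_le_maximal I0 hI0
  refine ⟨fun e => IsIdempotentElem e ∧ ∃ h : e ∈ Subring.center R, (⟨e, h⟩ : Subring.center R) ∈ m,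
    fun e h => h.1, ?_, ?_, ?_, ?_⟩
  · rintro e f ⟨he, he', hem⟩ ⟨hf, hf', hfm⟩
    refine ⟨idem_join he hf (habelian e he), hcen _ (idem_join he hf (habelian e he)), ?_⟩
    exact m.sub_mem (m.add_mem hem hfm) (m.mul_mem_right ⟨f, hf'⟩ hem)
  · intro e he
    have h0 : (⟨e, hcen e he⟩ : Subring.center R) * ⟨1 - e, hcen _ he.one_sub⟩ ∈ m := by
      have : (⟨e, hcen e he⟩ : Subring.center R) * ⟨1 - e, hcen _ he.one_sub⟩ = 0 := by
        apply Subtype.ext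
        show e * (1 - e) = 0
        rw [mul_sub, he.eq, mul_one, sub_self]
      rw [this]; exact m.zero_mem
    rcases hm.isPrime.mem_or_mem h0 with h | h
    · exact .inl ⟨he, _, h⟩
    · exact .inr ⟨he.one_sub, _, h⟩
  · rintro e ⟨_, _, h1⟩ ⟨_, _, h2⟩
    apply hm.ne_top
    rw [Ideal.eq_top_iff_one]
    convert m.add_mem h1 h2 using 1
    apply Subtype.ext
    simp
  · intro e he hg
    exact ⟨he, hcen e he, hle ⟨e, he, hg, he⟩⟩

theorem isTwoGood_finite {R G : Type*} [Ring R] [Group G] [Finite G]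
    (habelian : ∀ e : R, IsIdempotentElem e → ∀ r : R, e * r = r * e)
    (hexchange : ∀ a : R, ∃ e : R, IsIdempotentElem e ∧
      (∃ r : R, e = a * r) ∧ (∃ s : R, 1 - e = (1 - a) * s))
    (h3 : ¬ ∃ f : R →+* ZMod 2, Function.Surjective f) (x : MonoidAlgebra R G) : IsTwoGood x := by
  by_contra hx
  let φ : R →+* MonoidAlgebra R G := MonoidAlgebra.singleOneRingHom
  have hφ : ∀ e, IsIdempotentElem e → ∀ a, φ e * a = a * φ e := fun e he a =>
    MonoidAlgebra.single_commute (fun _ => Commute.one_left _) (fun r => habelian e he r) a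
  obtain ⟨M, Mid, Mj, Mor, Mnot, Mgood⟩ := exists_prime_idem φ hφ x hx habelian
  have M0 : M 0 := Mgood 0 IsIdempotentElem.zero ⟨0, 0, 0, 0, by simp⟩
  let I : Ideal R :=
    { carrier := {r | ∃ e, M e ∧ e * r = r}
      zero_mem' := ⟨0, M0, by simp⟩
      add_mem' := by
        rintro z w ⟨e, he, hz⟩ ⟨f, hf, hw⟩
        refine ⟨e + f - e * f, Mj _ _ he hf, ?_⟩
        rw [mul_add, join_absorb_left (habelian e (Mid _ he)) hz, join_absorb_right hw]
      smul_mem' := by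
        rintro c z ⟨e, he, hz⟩
        refine ⟨e, he, ?_⟩
        rw [smul_eq_mul, ← mul_assoc, habelian e (Mid _ he), mul_assoc, hz] }
  have hI2 : I.IsTwoSided := ⟨by
    rintro a b ⟨e, he, hz⟩
    exact ⟨e, he, by rw [← mul_assoc, hz]⟩⟩
  have hMI : ∀ e, M e → Ideal.Quotient.mk I e = 0 := fun e he =>
    Ideal.Quotient.eq_zero_iff_mem.2 ⟨e, he, Mid e he⟩
  have hnt : Nontrivial (R ⧸ I) := by
    rw [Ideal.Quotient.nontrivial_iff, Ne, Ideal.eq_top_iff_one]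
    rintro ⟨e, he, h1⟩
    have : e = 1 := by simpa using h1
    subst this
    exact Mnot 1 he (by simpa using M0)
  have hloc : ∀ a : R ⧸ I, (∃ r, a * r = 1) ∨ (∃ r, (1 - a) * r = 1) := by
    intro a
    obtain ⟨a, rfl⟩ := Ideal.Quotient.mk_surjective a
    obtain ⟨e, he, ⟨r, hr⟩, ⟨s, hs⟩⟩ := hexchange a
    rcases Mor e he with h | h
    · right
      refine ⟨Ideal.Quotient.mk I s, ?_⟩
      have := congrArg (Ideal.Quotient.mk I) hs
      rw [map_sub, hMI _ h, map_mul, map_sub, map_one, sub_zero] at this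
      exact this.symm
    · left
      refine ⟨Ideal.Quotient.mk I r, ?_⟩
      have h' := hMI _ h
      rw [map_sub, map_one, sub_eq_zero] at h'
      rw [← map_mul, ← hr, ← h']
  have h3' : ¬ ∃ f : R ⧸ I →+* ZMod 2, Function.Surjective f := by
    rintro ⟨f, hf⟩
    exact h3 ⟨f.comp (Ideal.Quotient.mk I), hf.comp Ideal.Quotient.mk_surjective⟩
  let q := MonoidAlgebra.mapRingHom G (Ideal.Quotient.mk I)
  have hq : Function.Surjective q := mapRingHom_surj _ Ideal.Quotient.mk_surjective
  have hadd : ∀ e f, M e → M f → ∃ k, M k ∧ (∀ a, φ e * a = a → φ k * a = a) ∧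
      (∀ a, φ f * a = a → φ k * a = a) := by
    intro e f he hf
    refine ⟨e + f - e * f, Mj _ _ he hf, fun a ha => ?_, fun a ha => ?_⟩
    · rw [map_sub, map_add, map_mul]
      exact join_absorb_left (hφ e (Mid _ he)) ha
    · rw [map_sub, map_add, map_mul]
      exact join_absorb_right ha
  have hker : ∀ c, q c = 0 → ∃ e, M e ∧ φ e * c = c := by
    intro c hc
    rw [← MonoidAlgebra.sum_coeff_single c]
    refine Finset.sum_induction _ (fun c => ∃ e, M e ∧ φ e * c = c) ?_ ⟨0, M0, by simp⟩ ?_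
    · rintro a b ⟨e, he, ha⟩ ⟨f, hf, hb⟩
      obtain ⟨k, hk, h1, h2⟩ := hadd e f he hf
      exact ⟨k, hk, by rw [mul_add, h1 a ha, h2 b hb]⟩
    · intro g _
      have hg : c.coeff g ∈ I := by
        rw [← Ideal.Quotient.eq_zero_iff_mem, ← MonoidAlgebra.coeff_mapRingHom]
        show (q c).coeff g = 0
        rw [hc]; rfl
      obtain ⟨e, he, h⟩ := hg
      refine ⟨e, he, ?_⟩
      show MonoidAlgebra.single 1 e * MonoidAlgebra.single g (c.coeff g) = _
      rw [MonoidAlgebra.single_mul_single, one_mul, h]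
  obtain ⟨_, _, ⟨U, rfl⟩, ⟨V, rfl⟩, hUV⟩ := isTwoGood_local hloc h3' (q x)
  obtain ⟨u, hu⟩ := hq U
  obtain ⟨u', hu'⟩ := hq (↑U⁻¹ : MonoidAlgebra (R ⧸ I) G)
  obtain ⟨v, hv⟩ := hq V
  obtain ⟨v', hv'⟩ := hq (↑V⁻¹ : MonoidAlgebra (R ⧸ I) G)
  obtain ⟨e0, m0, k0⟩ := hker (x - (u + v)) (by rw [map_sub, map_add, hUV, hu, hv, sub_self])
  obtain ⟨e1, m1, k1⟩ := hker (u * u' - 1) (by rw [map_sub, map_mul, map_one, hu, hu']; simp)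
  obtain ⟨e2, m2, k2⟩ := hker (u' * u - 1) (by rw [map_sub, map_mul, map_one, hu, hu']; simp)
  obtain ⟨e3, m3, k3⟩ := hker (v * v' - 1) (by rw [map_sub, map_mul, map_one, hv, hv']; simp)
  obtain ⟨e4, m4, k4⟩ := hker (v' * v - 1) (by rw [map_sub, map_mul, map_one, hv, hv']; simp)
  obtain ⟨a, ma, a0, a1⟩ := hadd e0 e1 m0 m1
  obtain ⟨b, mb, b0, b1⟩ := hadd e2 e3 m2 m3
  obtain ⟨c, mc, c0, c1⟩ := hadd a b ma mb
  obtain ⟨d, md, d0, d1⟩ := hadd c e4 mc m4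
  have fin : ∀ y z, φ d * (y - z) = y - z → φ (1 - d) * y = φ (1 - d) * z := by
    intro y z h
    rw [← sub_eq_zero, ← mul_sub, map_sub, sub_mul, h, map_one, one_mul, sub_self]
  refine Mnot d md (Mgood _ (Mid _ md).one_sub ⟨u, u', v, v', ?_, ?_, ?_, ?_, ?_⟩)
  · exact fin _ _ (d0 _ (c0 _ (a0 _ k0)))
  · rw [fin _ 1 (d0 _ (c0 _ (a1 _ k1))), mul_one]
  · rw [fin _ 1 (d0 _ (c1 _ (b0 _ k2))), mul_one]
  · rw [fin _ 1 (d0 _ (c1 _ (b1 _ k3))), mul_one]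
  · rw [fin _ 1 (d1 _ k4), mul_one]

/-- For an Abelian exchange ring `R` and a locally finite group `G`, the following are
equivalent: (i) the identity of `RG` is a sum of two units; (ii) the identity of `R` is a
sum of two units; (iii) `R` has no factor ring isomorphic to `ℤ/2ℤ`; (iv) every element
of `RG` is a sum of two units. -/
theorem monoidAlgebra_sum_of_two_units_tfae {R : Type*} [Ring R] {G : Type*} [Group G]
    (habelian : ∀ e : R, IsIdempotentElem e → ∀ r : R, e * r = r * e)
    (hexchange : ∀ a : R, ∃ e : R, IsIdempotentElem e ∧
      (∃ r : R, e = a * r) ∧ (∃ s : R, 1 - e = (1 - a) * s))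
    (hLF : ∀ s : Finset G, Finite (Subgroup.closure (s : Set G))) :
    [(∃ u v : MonoidAlgebra R G, IsUnit u ∧ IsUnit v ∧ (1 : MonoidAlgebra R G) = u + v),
     (∃ u v : R, IsUnit u ∧ IsUnit v ∧ (1 : R) = u + v),
     (¬ ∃ f : R →+* ZMod 2, Function.Surjective f),
     (∀ x : MonoidAlgebra R G, ∃ u v : MonoidAlgebra R G,
        IsUnit u ∧ IsUnit v ∧ x = u + v)].TFAE := by
  tfae_have 4 → 1 := fun h => h 1
  tfae_have 1 → 2 := by
    intro h
    -- the augmentation map, as a map to the group ring of the trivial group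
    let ψ : MonoidAlgebra R G →+* MonoidAlgebra R Unit :=
      MonoidAlgebra.mapDomainRingHom R (1 : G →* Unit)
    have h1 : IsTwoGood (1 : MonoidAlgebra R Unit) := by
      have := IsTwoGood.map ψ h
      rwa [map_one] at this
    have := h1.map (MonoidAlgebra.uniqueRingEquiv (R := R) Unit).toRingHom
    rw [map_one] at this
    exact this
  tfae_have 2 → 3 := by
    rintro ⟨u, v, hu, hv, h⟩ ⟨f, -⟩
    have h1 := congrArg f h
    rw [map_one, map_add] at h1
    have hu' := (hu.map f).ne_zero
    have hv' := (hv.map f).ne_zero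
    generalize f u = a at *
    generalize f v = b at *
    revert a b
    decide
  tfae_have 3 → 4 := by
    intro h3 x
    have := hLF x.coeff.support
    let ι : MonoidAlgebra R (Subgroup.closure (x.coeff.support : Set G)) →+* MonoidAlgebra R G :=
      MonoidAlgebra.mapDomainRingHom R (Subgroup.subtype _)
    have hx : x ∈ ι.range := by
      suffices h : x.coeff.sum MonoidAlgebra.single ∈ ι.range by
        rwa [MonoidAlgebra.sum_coeff_single x] at h
      refine Subring.sum_mem _ fun g hg => ?_
      refine ⟨MonoidAlgebra.single ⟨g, Subgroup.subset_closure hg⟩ (x.coeff g), ?_⟩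
      simp [ι]
    obtain ⟨y, hy⟩ := hx
    have := (isTwoGood_finite habelian hexchange h3 y).map ι
    rw [hy] at this
    exact this
  tfae_finish
end
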